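/- arXiv:math/0612643 — 2 statements merged into one kernel-verified Lean document; each statement's English description precedes it below -/
import Mathlib

section
/- Let (a,b,c,d) ∈ P_gen and let γ ∈ ℂ* lie outside S_pol = {sq^k : k ∈ ℤ, k ≥ 0} ∪ {s⁻¹q^{−k} : k ∈ ℤ, k ≥ 0}. Then the complex vector space V_{μ(γ)} has dimension 2, and the restriction maps V_{μ(γ)} → V_{μ(γ)}⁺, f ↦ f restricted to ℝ_q⁺, and V_{μ(γ)} → V_{μ(γ)}⁻, f ↦ f restricted to ℝ_q⁻, are linear isomorphisms; in particular every function in V_{μ(γ)}⁺ (respectively V_{μ(γ)}⁻) has a unique extension to an element of V_{μ(γ)}. -/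
open Complex Filter

noncomputable section

namespace VVBQJ

/-- The infinite q-shifted factorial `(x;q)_∞`. -/
def poch (q x : ℂ) : ℂ := ∏' j : ℕ, (1 - x * q ^ j)

/-- The q-shifted factorial `(x;q)_n`, `n ∈ ℕ`. -/
def pochN (q x : ℂ) (n : ℕ) : ℂ := ∏ j ∈ Finset.range n, (1 - x * q ^ j)

/-- The normalized Jacobi theta function `θ(x) = (x;q)_∞ (q/x;q)_∞`. -/
def theta (q x : ℂ) : ℂ := poch q x * poch q (q / x)

/-- The condition on the pairs `(a,b)` and `(c,d)` in the parameter set `P`. -/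
def pairCond (q zm zp : ℝ) (α β : ℂ) : Prop :=
  α = (starRingEnd ℂ) β ∨
    (∃ (A B : ℝ) (k₀ : ℤ), α = (A : ℂ) ∧ β = (B : ℂ) ∧
      zp * q ^ k₀ < 1 / B ∧ 1 / B < 1 / A ∧ 1 / A < zp * q ^ (k₀ - 1)) ∨
    (∃ (A B : ℝ) (k₀ : ℤ), α = (A : ℂ) ∧ β = (B : ℂ) ∧
      zm * q ^ (k₀ - 1) < 1 / A ∧ 1 / A < 1 / B ∧ 1 / B < zm * q ^ k₀)

/-- The parameter domain `P`. -/
def memP (q zm zp : ℝ) (a b c d : ℂ) : Prop :=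
  a ≠ 0 ∧ b ≠ 0 ∧ c ≠ 0 ∧ d ≠ 0 ∧ a ≠ b ∧
    (∀ x ∈ ({a, b, c, d} : Set ℂ), ∀ k : ℤ,
      x ≠ ((zp : ℂ))⁻¹ * (q : ℂ) ^ k ∧ x ≠ ((zm : ℂ))⁻¹ * (q : ℂ) ^ k) ∧
    pairCond q zm zp a b ∧ pairCond q zm zp c d

/-- The generic parameter domain `P_gen`. -/
def memPgen (q zm zp : ℝ) (a b c d : ℂ) : Prop :=
  memP q zm zp a b c d ∧ c ≠ d ∧
    ∀ k : ℤ, c / a ≠ (q : ℂ) ^ k ∧ c / b ≠ (q : ℂ) ^ k ∧ d / a ≠ (q : ℂ) ^ k ∧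
      d / b ≠ (q : ℂ) ^ k ∧ c * d / (a * b) ≠ (q : ℂ) ^ k

/-- `s = √(cdq/(ab))`, with the principal branch of the square root. -/
def sP (q : ℝ) (a b c d : ℂ) : ℂ := (c * d * (q : ℂ) / (a * b)) ^ ((1 : ℂ) / 2)

def Acoef (q : ℝ) (a b c d : ℂ) (x : ℝ) : ℂ :=
  (sP q a b c d)⁻¹ * (1 - (q : ℂ) / (a * (x : ℂ))) * (1 - (q : ℂ) / (b * (x : ℂ)))

def Bcoef (q : ℝ) (a b c d : ℂ) (x : ℝ) : ℂ :=
  sP q a b c d * (1 - 1 / (c * (x : ℂ))) * (1 - 1 / (d * (x : ℂ)))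

def Ccoef (q : ℝ) (a b c d : ℂ) (x : ℝ) : ℂ :=
  sP q a b c d + (sP q a b c d)⁻¹ - Acoef q a b c d x - Bcoef q a b c d x

/-- The second order q-difference operator `L`. -/
def Lop (q : ℝ) (a b c d : ℂ) (f : ℝ → ℂ) (x : ℝ) : ℂ :=
  Acoef q a b c d x * f (x / q) + Bcoef q a b c d x * f (q * x) + Ccoef q a b c d x * f x

/-- The weight function `w`. -/
def w (q : ℝ) (a b c d : ℂ) (x : ℝ) : ℂ :=
  poch q (a * (x : ℂ)) * poch q (b * (x : ℂ)) / (poch q (c * (x : ℂ)) * poch q (d * (x : ℂ)))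

/-- The function `u(x) = (1-q)² B(x) x² w(x)`. -/
def u (q : ℝ) (a b c d : ℂ) (x : ℝ) : ℂ :=
  (1 - (q : ℂ)) ^ 2 * Bcoef q a b c d x * (x : ℂ) ^ 2 * w q a b c d x

/-- The Casorati determinant `D(f,g)`. -/
def casD (q : ℝ) (a b c d : ℂ) (f g : ℝ → ℂ) (x : ℝ) : ℂ :=
  (f x * g (q * x) - f (q * x) * g x) * u q a b c d x / ((1 - (q : ℂ)) * (x : ℂ))

/-- The truncated inner product `⟨f,g⟩_{k,l;m,n}`. -/
def trunc (q zm zp : ℝ) (a b c d : ℂ) (f g : ℝ → ℂ) (k l m n : ℤ) : ℂ :=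
  (1 - (q : ℂ)) *
    ((∑ j ∈ Finset.Icc n m, f (zp * q ^ j) * (starRingEnd ℂ) (g (zp * q ^ j)) *
        w q a b c d (zp * q ^ j) * ((zp * q ^ j : ℝ) : ℂ)) -
      ∑ j ∈ Finset.Icc k l, f (zm * q ^ j) * (starRingEnd ℂ) (g (zm * q ^ j)) *
        w q a b c d (zm * q ^ j) * ((zm * q ^ j : ℝ) : ℂ))

/-- The constant `K_z`. -/
def Kz (q : ℝ) (a b c d : ℂ) (z : ℝ) : ℂ :=
  (z : ℂ) * (1 - (q : ℂ)) * (theta q (a * z) * theta q (b * z)) /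
    (theta q (c * z) * theta q (d * z))

/-- Membership in the Hilbert space `ℒ²(ℝ_q, w(x) d_q x)`. -/
def memL2 (q zm zp : ℝ) (a b c d : ℂ) (f : ℝ → ℂ) : Prop :=
  Summable (fun k : ℤ => ‖f (zp * q ^ k)‖ ^ 2 * ‖w q a b c d (zp * q ^ k)‖ * |zp * q ^ k|) ∧
    Summable (fun k : ℤ => ‖f (zm * q ^ k)‖ ^ 2 * ‖w q a b c d (zm * q ^ k)‖ * |zm * q ^ k|)

/-- The inner product on `ℒ²`. -/
def innerL2 (q zm zp : ℝ) (a b c d : ℂ) (f g : ℝ → ℂ) : ℂ :=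
  (1 - (q : ℂ)) *
    ((∑' k : ℤ, f (zp * q ^ k) * (starRingEnd ℂ) (g (zp * q ^ k)) *
        w q a b c d (zp * q ^ k) * ((zp * q ^ k : ℝ) : ℂ)) -
      ∑' k : ℤ, f (zm * q ^ k) * (starRingEnd ℂ) (g (zm * q ^ k)) *
        w q a b c d (zm * q ^ k) * ((zm * q ^ k : ℝ) : ℂ))

/-- The squared `ℒ²`-norm. -/
def normSqL2 (q zm zp : ℝ) (a b c d : ℂ) (f : ℝ → ℂ) : ℝ :=
  (1 - q) *
    ((∑' k : ℤ, ‖f (zp * q ^ k)‖ ^ 2 * ‖w q a b c d (zp * q ^ k)‖ * (zp * q ^ k)) +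
      ∑' k : ℤ, ‖f (zm * q ^ k)‖ ^ 2 * ‖w q a b c d (zm * q ^ k)‖ * (-(zm * q ^ k)))

/-- The q-difference operator `D_q`. -/
def Dq (q : ℝ) (f : ℝ → ℂ) (x : ℝ) : ℂ := (f x - f (q * x)) / ((1 - (q : ℂ)) * (x : ℂ))

/-- The q-line `ℝ_q`. -/
def Rq (q zm zp : ℝ) : Set ℝ := {x | ∃ k : ℤ, x = zm * q ^ k ∨ x = zp * q ^ k}

/-- Membership in the domain `𝒟`. -/
def memD (q zm zp : ℝ) (a b c d : ℂ) (f : ℝ → ℂ) : Prop :=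
  memL2 q zm zp a b c d f ∧ memL2 q zm zp a b c d (Lop q a b c d f) ∧
    (∃ v : ℂ, Tendsto (fun k : ℕ => f (zm * q ^ k)) atTop (nhds v) ∧
        Tendsto (fun k : ℕ => f (zp * q ^ k)) atTop (nhds v)) ∧
    (∃ v : ℂ, Tendsto (fun k : ℕ => Dq q f (zm * q ^ k)) atTop (nhds v) ∧
        Tendsto (fun k : ℕ => Dq q f (zp * q ^ k)) atTop (nhds v))

/-- Membership in the eigenspace `V_μ` (functions on `ℝ_q`). -/
def memV (q zm zp : ℝ) (a b c d : ℂ) (μ : ℂ) (f : ℝ → ℂ) : Prop :=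
  (∀ x ∈ Rq q zm zp, Lop q a b c d f x = μ * f x) ∧
    (∃ v : ℂ, Tendsto (fun k : ℕ => f (zm * q ^ k)) atTop (nhds v) ∧
        Tendsto (fun k : ℕ => f (zp * q ^ k)) atTop (nhds v)) ∧
    (∃ v : ℂ, Tendsto (fun k : ℕ => Dq q f (zm * q ^ k)) atTop (nhds v) ∧
        Tendsto (fun k : ℕ => Dq q f (zp * q ^ k)) atTop (nhds v))

/-- The set of regular spectral values `S_reg = ℂ* \ {± q^{k/2}}`. -/
def Sreg (q : ℝ) (γ : ℂ) : Prop :=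
  γ ≠ 0 ∧ ∀ k : ℤ, γ ≠ ((q ^ ((k : ℝ) / 2) : ℝ) : ℂ) ∧ γ ≠ -((q ^ ((k : ℝ) / 2) : ℝ) : ℂ)

/-- The big q-Jacobi function `φ_γ(x)`. -/
def phi (q : ℝ) (a b c d : ℂ) (γ x : ℂ) : ℂ :=
  ∑' n : ℕ,
    pochN q (q / (a * x)) n * pochN q (sP q a b c d * γ) n * pochN q (sP q a b c d / γ) n /
      (pochN q q n * pochN q (c * q / a) n * pochN q (d * q / a) n) * (b * x) ^ n

/-- The asymptotic solution `Φ_γ(z q^{-k})`, in index form. -/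
def PhiIdx (q : ℝ) (a b c d : ℂ) (γ : ℂ) (z : ℝ) (k : ℤ) : ℂ :=
  let s : ℂ := sP q a b c d
  let x : ℂ := (z : ℂ) * (q : ℂ) ^ (-k)
  (s * γ) ^ k *
    (poch q ((q : ℂ) / (b * x)) * poch q ((q : ℂ) ^ 2 * γ / (a * s * x)) /
      (poch q ((q : ℂ) / (c * x)) * poch q ((q : ℂ) / (d * x)))) *
    ∑' n : ℕ,
      pochN q ((q : ℂ) * γ / s) n * pochN q (c * q * γ / (s * a)) n *
          pochN q (d * q * γ / (s * a)) n /
        (pochN q q n * pochN q ((q : ℂ) ^ 2 * γ / (a * s * x)) n * pochN q ((q : ℂ) * γ ^ 2) n) *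
        ((q : ℂ) / (b * x)) ^ n

/-- Casorati determinant at `x = z q^{-k}` for index-form functions. -/
def casDIdx (q : ℝ) (a b c d : ℂ) (f g : ℤ → ℂ) (z : ℝ) (k : ℤ) : ℂ :=
  (f k * g (k - 1) - f (k - 1) * g k) * u q a b c d (z * q ^ (-k)) /
    ((1 - (q : ℂ)) * ((z * q ^ (-k) : ℝ) : ℂ))

/-- The c-function `c_z(γ)`. -/
def cz (q : ℝ) (a b c d : ℂ) (z : ℝ) (γ : ℂ) : ℂ :=
  let s : ℂ := sP q a b c d
  poch q (s / γ) * poch q (c * q / (a * s * γ)) * poch q (d * q / (a * s * γ)) *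
      theta q (b * s * z * γ) /
    (poch q (c * q / a) * poch q (d * q / a) * poch q (1 / γ ^ 2) * theta q (b * z))

/-- The expansion coefficient `d_z(γ)`. -/
def dz (q : ℝ) (a b c d : ℂ) (z : ℝ) (γ : ℂ) : ℂ :=
  let s : ℂ := sP q a b c d
  (poch q (c * q / a) * poch q (d * q / a) * theta q (b * z) /
      (theta q (a / b) * theta q (c * z) * theta q (d * z))) *
    (poch q (c * q * γ / (s * b)) * poch q (d * q * γ / (s * b)) *
        theta q (a * s * z / (q * γ)) /
      (poch q (q * γ ^ 2) * poch q (s / γ)))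

/-- The Casorati determinant `v(γ) = D(Φ_γ^+, Φ_γ^-)`. -/
def vFun (q zm zp : ℝ) (a b c d : ℂ) (γ : ℂ) : ℂ :=
  let s : ℂ := sP q a b c d;
  -((zp : ℂ) * (1 - (q : ℂ)) * theta q ((zm : ℂ) / zp) /
      (theta q (c * zm) * theta q (d * zm) * theta q (c * zp) * theta q (d * zp))) *
    (poch q (c * q * γ / (a * s)) * poch q (d * q * γ / (a * s)) * poch q (c * q * γ / (b * s)) *
        poch q (d * q * γ / (b * s)) * poch q (s * γ) * poch q (q * γ / s) *
        theta q (a * b * s * zm * zp / (q * γ)) /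
      (γ * (poch q (q * γ ^ 2)) ^ 2))

/-- The function `v₁(γ)` in the continuous part of the spectral measure. -/
def v1Fun (q zm zp : ℝ) (a b c d : ℂ) (γ : ℂ) : ℂ :=
  let s : ℂ := sP q a b c d
  ((poch q (c * q / a)) ^ 2 * (poch q (d * q / a)) ^ 2 * theta q (b * zp) * theta q (b * zm) /
      ((1 - (q : ℂ)) * a * b * (zm : ℂ) ^ 2 * (zp : ℂ) ^ 2 *
        (theta q ((zm : ℂ) / zp) * theta q ((zp : ℂ) / zm) * theta q (a / b) * theta q (b / a)))) *
    (poch q (γ ^ 2) * poch q (γ⁻¹ ^ 2) /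
      (poch q (s * γ) * poch q (s / γ) * poch q (c * q * γ / (a * s)) *
        poch q (c * q / (a * s * γ)) * poch q (d * q * γ / (a * s)) *
        poch q (d * q / (a * s * γ)) *
        (theta q (s * γ) * theta q (s / γ) * theta q (a * b * s * zm * zp * γ) *
          theta q (a * b * s * zm * zp / γ)))) *
    ((zm : ℂ) * (theta q (a * zp) * theta q (c * zp) * theta q (d * zp) * theta q (b * zm) *
          theta q (a * s * zm * γ) * theta q (a * s * zm / γ)) -
      (zp : ℂ) * (theta q (a * zm) * theta q (c * zm) * theta q (d * zm) * theta q (b * zp) *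
          theta q (a * s * zp * γ) * theta q (a * s * zp / γ)))

/-- The function `v₂(γ)` in the continuous part of the spectral measure. -/
def v2Fun (q zm zp : ℝ) (a b c d : ℂ) (γ : ℂ) : ℂ :=
  let s : ℂ := sP q a b c d
  (poch q (c * q / a) * poch q (d * q / a) * poch q (c * q / b) * poch q (d * q / b) *
      (theta q (a * zp) * theta q (a * zm) * theta q (b * zp) * theta q (b * zm) *
        theta q (c * d * zm * zp)) /
      (a * b * (zm : ℂ) ^ 2 * (zp : ℂ) * (1 - (q : ℂ)) *
        (theta q ((zp : ℂ) / zm) * theta q (a / b) * theta q (b / a)))) *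
    (poch q (γ ^ 2) * poch q (γ⁻¹ ^ 2) /
      (poch q (s * γ) * poch q (s / γ) *
        (theta q (s * γ) * theta q (s / γ) * theta q (a * b * s * zm * zp * γ) *
          theta q (a * b * s * zm * zp / γ))))

/-- The function `u₁(γ)`. -/
def u1Fun (q zm zp : ℝ) (a b c d : ℂ) (γ : ℂ) : ℂ :=
  Kz q a b c d zp * cz q a b c d zp γ * cz q a b c d zp γ⁻¹ -
    Kz q a b c d zm * cz q a b c d zm γ * cz q a b c d zm γ⁻¹

/-- The function `u₂(γ)`. -/
def u2Fun (q zm zp : ℝ) (a b c d : ℂ) (γ : ℂ) : ℂ :=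
  Kz q a b c d zp * cz q a b c d zp γ * cz q b a c d zp γ⁻¹ -
    Kz q a b c d zm * cz q a b c d zm γ * cz q b a c d zm γ⁻¹

/-- The big q-Jacobi polynomial `P_k(y; α, β, δ; q)`. -/
def bigqJacobiP (q : ℝ) (α β δ : ℂ) (k : ℕ) (y : ℂ) : ℂ :=
  ∑ j ∈ Finset.range (k + 1),
    pochN q (((q : ℂ) ^ k)⁻¹) j * pochN q (α * β * (q : ℂ) ^ (k + 1)) j * pochN q y j /
      (pochN q q j * pochN q (α * q) j * pochN q (δ * q) j) * (q : ℂ) ^ j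

/-- The q-derivative at `z q^k`, in index form. -/
def dqIdx (q z : ℝ) (F : ℤ → ℂ) (k : ℤ) : ℂ :=
  (F k - F (k + 1)) / ((1 - (q : ℂ)) * ((z * q ^ k : ℝ) : ℂ))

/-- The eigenspace `V_μ^±` of `L` on the half line `{z q^k}`, in index form. -/
def Veig (q : ℝ) (a b c d : ℂ) (z : ℝ) (μ : ℂ) : Submodule ℂ (ℤ → ℂ) where
  carrier := {F | ∀ k : ℤ,
    Acoef q a b c d (z * q ^ k) * F (k - 1) + Bcoef q a b c d (z * q ^ k) * F (k + 1) +
      Ccoef q a b c d (z * q ^ k) * F k = μ * F k}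
  add_mem' := by
    intro f g hf hg k
    have h1 := hf k
    have h2 := hg k
    simp only [Pi.add_apply]
    linear_combination h1 + h2
  zero_mem' := by
    intro k
    simp
  smul_mem' := by
    intro t f hf k
    have h := hf k
    simp only [Pi.smul_apply, smul_eq_mul]
    linear_combination t * h

/-- The eigenspace `V_μ` of `L` on `ℝ_q`, in index form: the first component is the
restriction to `ℝ_q⁻`, the second the restriction to `ℝ_q⁺`. -/
def Vfull (q zm zp : ℝ) (a b c d : ℂ) (μ : ℂ) : Submodule ℂ ((ℤ → ℂ) × (ℤ → ℂ)) where
  carrier := {F |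
    F.1 ∈ Veig q a b c d zm μ ∧ F.2 ∈ Veig q a b c d zp μ ∧
    (∃ v : ℂ, Tendsto (fun n : ℕ => F.1 n) atTop (nhds v) ∧
        Tendsto (fun n : ℕ => F.2 n) atTop (nhds v)) ∧
    (∃ v : ℂ, Tendsto (fun n : ℕ => dqIdx q zm F.1 n) atTop (nhds v) ∧
        Tendsto (fun n : ℕ => dqIdx q zp F.2 n) atTop (nhds v))}
  add_mem' := by
    intro f g hf hg
    obtain ⟨hf1, hf2, ⟨v1, hv1, hv2⟩, ⟨v2, hw1, hw2⟩⟩ := hf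
    obtain ⟨hg1, hg2, ⟨v1', hv1', hv2'⟩, ⟨v2', hw1', hw2'⟩⟩ := hg
    refine ⟨(Veig q a b c d zm μ).add_mem hf1 hg1, (Veig q a b c d zp μ).add_mem hf2 hg2,
      ⟨v1 + v1', ?_, ?_⟩, ⟨v2 + v2', ?_, ?_⟩⟩
    · exact hv1.add hv1'
    · exact hv2.add hv2'
    · have h : (fun n : ℕ => dqIdx q zm (f + g).1 n) =
          fun n : ℕ => dqIdx q zm f.1 n + dqIdx q zm g.1 n := by
        funext n
        simp only [dqIdx, Prod.fst_add, Pi.add_apply]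
        ring
      rw [h]
      exact hw1.add hw1'
    · have h : (fun n : ℕ => dqIdx q zp (f + g).2 n) =
          fun n : ℕ => dqIdx q zp f.2 n + dqIdx q zp g.2 n := by
        funext n
        simp only [dqIdx, Prod.snd_add, Pi.add_apply]
        ring
      rw [h]
      exact hw2.add hw2'
  zero_mem' := by
    refine ⟨(Veig q a b c d zm μ).zero_mem, (Veig q a b c d zp μ).zero_mem,
      ⟨0, ?_, ?_⟩, ⟨0, ?_, ?_⟩⟩ <;>
    · simp only [Prod.fst_zero, Prod.snd_zero, Pi.zero_apply, dqIdx, sub_zero, sub_self,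
        zero_div]
      exact tendsto_const_nhds
  smul_mem' := by
    intro t f hf
    obtain ⟨hf1, hf2, ⟨v1, hv1, hv2⟩, ⟨v2, hw1, hw2⟩⟩ := hf
    refine ⟨(Veig q a b c d zm μ).smul_mem t hf1, (Veig q a b c d zp μ).smul_mem t hf2,
      ⟨t * v1, ?_, ?_⟩, ⟨t * v2, ?_, ?_⟩⟩
    · exact hv1.const_mul t
    · exact hv2.const_mul t
    · have h : (fun n : ℕ => dqIdx q zm (t • f).1 n) =
          fun n : ℕ => t * dqIdx q zm f.1 n := by
        funext n
        simp only [dqIdx, Prod.smul_fst, Pi.smul_apply, smul_eq_mul]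
        ring
      rw [h]
      exact hw1.const_mul t
    · have h : (fun n : ℕ => dqIdx q zp (t • f).2 n) =
          fun n : ℕ => t * dqIdx q zp f.2 n := by
        funext n
        simp only [dqIdx, Prod.smul_snd, Pi.smul_apply, smul_eq_mul]
        ring
      rw [h]
      exact hw2.const_mul t

/-- Restriction of an element of `V_μ` to `ℝ_q⁺`. -/
def resPlus (q zm zp : ℝ) (a b c d : ℂ) (μ : ℂ) :
    Vfull q zm zp a b c d μ →ₗ[ℂ] Veig q a b c d zp μ where
  toFun F := ⟨F.1.2, F.2.2.1⟩
  map_add' F G := rfl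
  map_smul' t F := rfl

/-- Restriction of an element of `V_μ` to `ℝ_q⁻`. -/
def resMinus (q zm zp : ℝ) (a b c d : ℂ) (μ : ℂ) :
    Vfull q zm zp a b c d μ →ₗ[ℂ] Veig q a b c d zm μ where
  toFun F := ⟨F.1.1, F.2.1⟩
  map_add' F G := rfl
  map_smul' t F := rfl

/-- A sequence whose relative increments decay geometrically converges, and its limit can only
vanish if the sequence hits zero. -/
lemma exists_tendsto_of_norm_sub_le {E : Type*} [NormedAddCommGroup E] [CompleteSpace E]
    {u : ℕ → E} {q K : ℝ} (hq0 : 0 < q) (hq1 : q < 1) (hK : 0 ≤ K)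
    (hu : ∀ n, ‖u (n + 1) - u n‖ ≤ K * q ^ n * ‖u n‖) :
    ∃ l, Tendsto u atTop (nhds l) ∧ (l = 0 → ∃ N, u N = 0) := by
  have hgeom : ∀ N n : ℕ, ∑ j ∈ Finset.range n, K * q ^ (N + j) ≤ K * q ^ N / (1 - q) := by
    intro N n
    have h1 : ∑ j ∈ Finset.range n, q ^ j ≤ (1 - q)⁻¹ := by
      rw [← tsum_geometric_of_lt_one hq0.le hq1]
      exact (summable_geometric_of_lt_one hq0.le hq1).sum_le_tsum _
        fun i _ => pow_nonneg hq0.le i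
    have h2 : ∑ j ∈ Finset.range n, K * q ^ (N + j)
        = K * q ^ N * ∑ j ∈ Finset.range n, q ^ j := by
      rw [Finset.mul_sum]
      exact Finset.sum_congr rfl fun j _ => by ring
    rw [h2, div_eq_mul_inv]
    exact mul_le_mul_of_nonneg_left h1 (by positivity)
  have hbound : ∀ N n : ℕ,
      ‖u (N + n)‖ ≤ Real.exp (∑ j ∈ Finset.range n, K * q ^ (N + j)) * ‖u N‖ := by
    intro N n
    induction n with
    | zero => simp
    | succ n ih =>
      have h1 := hu (N + n)
      have h2 : ‖u (N + n + 1)‖ ≤ ‖u (N + n + 1) - u (N + n)‖ + ‖u (N + n)‖ := by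
        simpa using norm_add_le (u (N + n + 1) - u (N + n)) (u (N + n))
      have h3 := Real.add_one_le_exp (K * q ^ (N + n))
      rw [Finset.sum_range_succ, Real.exp_add]
      calc ‖u (N + n + 1)‖ ≤ (K * q ^ (N + n) + 1) * ‖u (N + n)‖ := by linarith
        _ ≤ Real.exp (K * q ^ (N + n)) *
            (Real.exp (∑ j ∈ Finset.range n, K * q ^ (N + j)) * ‖u N‖) := by gcongr
        _ = _ := by ring
  have hlocal : ∀ N n : ℕ, ‖u (N + n + 1) - u (N + n)‖ ≤
      K * q ^ N * Real.exp (K * q ^ N / (1 - q)) * ‖u N‖ * q ^ n := by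
    intro N n
    calc ‖u (N + n + 1) - u (N + n)‖ ≤ K * q ^ (N + n) * ‖u (N + n)‖ := hu _
      _ ≤ K * q ^ (N + n) * (Real.exp (K * q ^ N / (1 - q)) * ‖u N‖) := by
        refine mul_le_mul_of_nonneg_left ((hbound N n).trans ?_) (by positivity)
        gcongr
        exact hgeom N n
      _ = _ := by ring
  have hdist : ∀ N n : ℕ, dist (u (N + n)) (u (N + (n + 1))) ≤
      K * q ^ N * Real.exp (K * q ^ N / (1 - q)) * ‖u N‖ * q ^ n := by
    intro N n
    rw [dist_comm, dist_eq_norm]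
    exact hlocal N n
  have hcauchy : CauchySeq u := by
    refine cauchySeq_of_le_geometric q (K * q ^ 0 * Real.exp (K * q ^ 0 / (1 - q)) * ‖u 0‖) hq1
      fun n => ?_
    have := hdist 0 n
    rwa [zero_add, zero_add] at this
  obtain ⟨l, hl⟩ := cauchySeq_tendsto_of_complete hcauchy
  refine ⟨l, hl, ?_⟩
  rintro rfl
  have hN : Tendsto (fun N : ℕ => K * q ^ N * Real.exp (K * q ^ N / (1 - q)) / (1 - q)) atTop
      (nhds 0) := by
    have h0 : Tendsto (fun N : ℕ => K * q ^ N) atTop (nhds 0) := by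
      simpa using (tendsto_pow_atTop_nhds_zero_of_lt_one hq0.le hq1).const_mul K
    have h1 := (h0.mul (Real.continuous_exp.continuousAt.tendsto.comp
      (h0.div_const (1 - q)))).div_const (1 - q)
    simpa using h1
  obtain ⟨N, hN⟩ := (hN.eventually_lt_const one_pos).exists
  refine ⟨N, ?_⟩
  have hshift : Tendsto (fun n => u (N + n)) atTop (nhds 0) := by
    simpa [add_comm] using (tendsto_add_atTop_iff_nat N).2 hl
  have h := dist_le_of_le_geometric_of_tendsto₀ q _ hq1 (hdist N) hshift
  simp only [add_zero, dist_zero_right] at h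
  by_contra hne
  have hpos : 0 < ‖u N‖ := norm_pos_iff.2 hne
  have : K * q ^ N * Real.exp (K * q ^ N / (1 - q)) * ‖u N‖ / (1 - q)
      = K * q ^ N * Real.exp (K * q ^ N / (1 - q)) / (1 - q) * ‖u N‖ := by ring
  rw [this] at h
  nlinarith

/-- Two-sided iteration of a family of bijections. -/
lemma exists_int_orbit {X : Type*} (T : ℤ → X ≃ X) (x : X) :
    ∃ p : ℤ → X, p 0 = x ∧ ∀ k, p (k + 1) = T k (p k) := by
  let up : ℕ → X := fun n => Nat.rec x (fun m y => T m y) n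
  let dn : ℕ → X := fun n => Nat.rec x (fun m y => (T (-(m : ℤ) - 1)).symm y) n
  refine ⟨fun k => if 0 ≤ k then up k.toNat else dn (-k).toNat, rfl, fun k => ?_⟩
  rcases le_or_gt 0 k with hk | hk
  · lift k to ℕ using hk
    have h : (0 : ℤ) ≤ (k : ℤ) + 1 := by positivity
    have h' : ((k : ℤ) + 1).toNat = k + 1 := by omega
    simp [h, h', up]
  · obtain ⟨m, rfl⟩ : ∃ m : ℕ, k = -(m : ℤ) - 1 := ⟨(-k - 1).toNat, by omega⟩
    have h2 : ¬ (0 : ℤ) ≤ -(m : ℤ) - 1 := by omega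
    have h3 : (-(-(m : ℤ) - 1)).toNat = m + 1 := by omega
    have h4 : T (-(m : ℤ) - 1) (dn (m + 1)) = dn m := Equiv.apply_symm_apply _ _
    simp only [h2, if_false, h3, h4]
    rcases Nat.eq_zero_or_pos m with rfl | hm
    · simp [up, dn]
    · have h5 : ¬ (0 : ℤ) ≤ -(m : ℤ) - 1 + 1 := by omega
      have h6 : (-(-(m : ℤ) - 1 + 1)).toNat = m := by omega
      simp only [h5, if_false, h6]

section ThreeTermRecurrence

variable {α β δ : ℤ → ℂ}

/-- A solution of a nondegenerate three-term recurrence with two consecutive zeros vanishes. -/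
lemma eq_zero_of_recurrence (hα : ∀ k, α k ≠ 0) (hβ : ∀ k, β k ≠ 0) {F : ℤ → ℂ}
    (hF : ∀ k, α k * F (k - 1) + β k * F (k + 1) + δ k * F k = 0) {N : ℤ}
    (h0 : F N = 0) (h1 : F (N + 1) = 0) (k : ℤ) : F k = 0 := by
  have key : F k = 0 ∧ F (k + 1) = 0 := by
    induction k using Int.inductionOn' (b := N) with
    | zero => exact ⟨h0, h1⟩
    | succ k _ ih =>
      refine ⟨ih.2, ?_⟩
      have h := hF (k + 1)
      rw [add_sub_cancel_right, ih.1, ih.2] at h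
      simpa [hβ] using h
    | pred k _ ih =>
      rw [sub_add_cancel]
      refine ⟨?_, ih.1⟩
      have h := hF k
      rw [ih.1, ih.2] at h
      simpa [hα] using h
  exact key.1

/-- A nondegenerate three-term recurrence has a solution with prescribed values at `0` and `1`. -/
lemma exists_recurrence_solution (hα : ∀ k, α k ≠ 0) (hβ : ∀ k, β k ≠ 0) (v : ℂ × ℂ) :
    ∃ F : ℤ → ℂ, (∀ k, α k * F (k - 1) + β k * F (k + 1) + δ k * F k = 0) ∧
      F 0 = v.1 ∧ F 1 = v.2 := by
  let T : ℤ → (ℂ × ℂ) ≃ (ℂ × ℂ) := fun k =>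
    { toFun := fun p => (p.2, -(α (k + 1) * p.1 + δ (k + 1) * p.2) / β (k + 1))
      invFun := fun p => (-(β (k + 1) * p.2 + δ (k + 1) * p.1) / α (k + 1), p.1)
      left_inv := fun p => by
        have h1 := hα (k + 1)
        have h2 := hβ (k + 1)
        refine Prod.ext ?_ rfl
        dsimp only
        field_simp
        ring
      right_inv := fun p => by
        have h1 := hα (k + 1)
        have h2 := hβ (k + 1)
        refine Prod.ext rfl ?_
        dsimp only
        field_simp
        ring }
  obtain ⟨p, hp0, hp⟩ := exists_int_orbit T v
  have hfst : ∀ k, (p (k + 1)).1 = (p k).2 := fun k => by rw [hp]; rfl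
  refine ⟨fun k => (p k).1, fun k => ?_, by simp [hp0], ?_⟩
  · have h1 : (p (k + 1)).1 = -(α k * (p (k - 1)).1 + δ k * (p k).1) / β k := by
      have h2 := hp (k - 1)
      have h3 := hfst (k - 1)
      rw [sub_add_cancel] at h2 h3
      rw [hfst, h3, h2]
      simp [T]
    have h2 := hβ k
    dsimp only
    rw [h1]
    field_simp
    ring
  · have := hfst 0
    rw [zero_add] at this
    dsimp only
    rw [this, hp0]

end ThreeTermRecurrence

/-- Nonvanishing data making `L` a regular second-order operator on `{z q^k}`. -/
structure Regular (q z : ℝ) (a b c d : ℂ) : Prop where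
  q_pos : 0 < q
  q_lt_one : q < 1
  z_ne : z ≠ 0
  a_ne : a ≠ 0
  b_ne : b ≠ 0
  c_ne : c ≠ 0
  d_ne : d ≠ 0
  avoid : ∀ y ∈ ({a, b, c, d} : Set ℂ), ∀ k : ℤ, y ≠ (z : ℂ)⁻¹ * (q : ℂ) ^ k

namespace Regular

variable {q z : ℝ} {a b c d : ℂ}

lemma qC_ne (h : Regular q z a b c d) : (q : ℂ) ≠ 0 := by exact_mod_cast h.q_pos.ne'

lemma one_sub_qC_ne (h : Regular q z a b c d) : (1 : ℂ) - q ≠ 0 := by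
  have := sub_pos.2 h.q_lt_one
  exact_mod_cast this.ne'

lemma x_ne (h : Regular q z a b c d) (k : ℤ) : (z : ℂ) * (q : ℂ) ^ k ≠ 0 :=
  mul_ne_zero (by exact_mod_cast h.z_ne) (zpow_ne_zero _ h.qC_ne)

lemma sP_sq (q : ℝ) (a b c d : ℂ) : sP q a b c d ^ 2 = c * d * q / (a * b) := by
  rw [sP, one_div]
  exact Complex.cpow_nat_inv_pow _ two_ne_zero

lemma sP_ne (h : Regular q z a b c d) : sP q a b c d ≠ 0 := by
  have h1 := sP_sq q a b c d
  intro h0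
  rw [h0] at h1
  have : c * d * (q : ℂ) / (a * b) ≠ 0 :=
    div_ne_zero (mul_ne_zero (mul_ne_zero h.c_ne h.d_ne) h.qC_ne) (mul_ne_zero h.a_ne h.b_ne)
  exact this (by simpa using h1.symm)

lemma mul_x_ne (h : Regular q z a b c d) {y : ℂ} (hy : y ∈ ({a, b, c, d} : Set ℂ)) (k m : ℤ) :
    y * ((z : ℂ) * (q : ℂ) ^ k) ≠ (q : ℂ) ^ m := by
  intro h0
  refine h.avoid y hy (m - k) ?_
  have h1 : (z : ℂ) ≠ 0 := by exact_mod_cast h.z_ne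
  have h2 := zpow_ne_zero k h.qC_ne
  rw [zpow_sub₀ h.qC_ne, ← h0]
  field_simp

lemma x_sub_ne (h : Regular q z a b c d) {y : ℂ} (hy : y ∈ ({a, b, c, d} : Set ℂ)) (hy0 : y ≠ 0)
    (k m : ℤ) : (z : ℂ) * (q : ℂ) ^ k - (q : ℂ) ^ m / y ≠ 0 := by
  intro h0
  apply h.mul_x_ne hy k m
  rw [sub_eq_zero.1 h0]
  field_simp

lemma Acoef_mul_sq (h : Regular q z a b c d) (k : ℤ) :
    Acoef q a b c d (z * q ^ k) * ((z : ℂ) * (q : ℂ) ^ k) ^ 2 =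
      (sP q a b c d)⁻¹ * ((z : ℂ) * (q : ℂ) ^ k - q / a) * ((z : ℂ) * (q : ℂ) ^ k - q / b) := by
  have h1 := h.x_ne k
  have ha := h.a_ne
  have hb := h.b_ne
  have hs := h.sP_ne
  simp only [Acoef]
  push_cast
  generalize (z : ℂ) * (q : ℂ) ^ k = x at *
  field_simp

lemma Bcoef_mul_sq (h : Regular q z a b c d) (k : ℤ) :
    Bcoef q a b c d (z * q ^ k) * ((z : ℂ) * (q : ℂ) ^ k) ^ 2 =
      sP q a b c d * ((z : ℂ) * (q : ℂ) ^ k - 1 / c) * ((z : ℂ) * (q : ℂ) ^ k - 1 / d) := by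
  have h1 := h.x_ne k
  have hc := h.c_ne
  have hd := h.d_ne
  simp only [Bcoef]
  push_cast
  generalize (z : ℂ) * (q : ℂ) ^ k = x at *
  field_simp

lemma Acoef_ne (h : Regular q z a b c d) (k : ℤ) : Acoef q a b c d (z * q ^ k) ≠ 0 := by
  refine left_ne_zero_of_mul (b := ((z : ℂ) * (q : ℂ) ^ k) ^ 2) ?_
  rw [h.Acoef_mul_sq]
  have h1 := h.x_sub_ne (y := a) (by simp) h.a_ne k 1
  have h2 := h.x_sub_ne (y := b) (by simp) h.b_ne k 1
  rw [zpow_one] at h1 h2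
  exact mul_ne_zero (mul_ne_zero (inv_ne_zero h.sP_ne) h1) h2

lemma Bcoef_mul_sq_ne (h : Regular q z a b c d) (k : ℤ) :
    sP q a b c d * ((z : ℂ) * (q : ℂ) ^ k - 1 / c) * ((z : ℂ) * (q : ℂ) ^ k - 1 / d) ≠ 0 := by
  have h1 := h.x_sub_ne (y := c) (by simp) h.c_ne k 0
  have h2 := h.x_sub_ne (y := d) (by simp) h.d_ne k 0
  rw [zpow_zero] at h1 h2
  exact mul_ne_zero (mul_ne_zero h.sP_ne h1) h2

lemma Bcoef_ne (h : Regular q z a b c d) (k : ℤ) : Bcoef q a b c d (z * q ^ k) ≠ 0 := by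
  refine left_ne_zero_of_mul (b := ((z : ℂ) * (q : ℂ) ^ k) ^ 2) ?_
  rw [h.Bcoef_mul_sq]
  exact h.Bcoef_mul_sq_ne k

lemma recurrence {μ : ℂ} (F : Veig q a b c d z μ) (k : ℤ) :
    Acoef q a b c d (z * q ^ k) * F.1 (k - 1) + Bcoef q a b c d (z * q ^ k) * F.1 (k + 1) +
      (Ccoef q a b c d (z * q ^ k) - μ) * F.1 k = 0 := by
  linear_combination F.2 k

lemma eq_zero_of_consecutive (h : Regular q z a b c d) {μ : ℂ} (F : Veig q a b c d z μ) {N : ℤ}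
    (h0 : F.1 N = 0) (h1 : F.1 (N + 1) = 0) : F = 0 :=
  Subtype.ext (funext fun k => eq_zero_of_recurrence
    (δ := fun k => Ccoef q a b c d (z * q ^ k) - μ) h.Acoef_ne h.Bcoef_ne (recurrence F) h0 h1 k)

/-- Solutions on a half line are parametrized by their values at two consecutive points. -/
def initialEquiv (h : Regular q z a b c d) (μ : ℂ) : Veig q a b c d z μ ≃ₗ[ℂ] ℂ × ℂ :=
  LinearEquiv.ofBijective
    { toFun := fun F => (F.1 0, F.1 1)
      map_add' := fun _ _ => rfl
      map_smul' := fun _ _ => rfl } <| by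
    constructor
    · rw [← LinearMap.ker_eq_bot, LinearMap.ker_eq_bot']
      intro F hF
      exact h.eq_zero_of_consecutive F (N := 0) (congrArg Prod.fst hF) (congrArg Prod.snd hF)
    · intro v
      obtain ⟨F, hF, h0, h1⟩ := exists_recurrence_solution
        (δ := fun k => Ccoef q a b c d (z * q ^ k) - μ) h.Acoef_ne h.Bcoef_ne v
      exact ⟨⟨F, fun k => by linear_combination hF k⟩, Prod.ext h0 h1⟩

lemma apply_succ (h : Regular q z a b c d) (F : ℤ → ℂ) (k : ℤ) :
    F (k + 1) = F k - (1 - q) * ((z : ℂ) * (q : ℂ) ^ k) * dqIdx q z F k := by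
  have h1 := h.x_ne k
  have h2 := h.one_sub_qC_ne
  simp only [dqIdx]
  push_cast
  generalize (z : ℂ) * (q : ℂ) ^ k = x at *
  field_simp
  ring

/-- Numerator of the coefficient of `D_q f` in the increment of `D_q f`. -/
def numer (q : ℝ) (a b c d : ℂ) (x : ℂ) : ℂ :=
  ((sP q a b c d)⁻¹ / q - sP q a b c d) * x - (sP q a b c d)⁻¹ * (1 / a + 1 / b) +
    sP q a b c d * (1 / c + 1 / d)

/-- The increment of the q-derivative of an eigenfunction is `O(x)`. -/
lemma dqIdx_succ_sub (h : Regular q z a b c d) {μ : ℂ} (F : Veig q a b c d z μ) (k : ℤ) :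
    sP q a b c d * ((z : ℂ) * (q : ℂ) ^ (k + 1) - 1 / c) * ((z : ℂ) * (q : ℂ) ^ (k + 1) - 1 / d) *
        (dqIdx q z F.1 (k + 1) - dqIdx q z F.1 k) =
      (z : ℂ) * (q : ℂ) ^ (k + 1) *
        (numer q a b c d ((z : ℂ) * (q : ℂ) ^ (k + 1)) * dqIdx q z F.1 k -
          (μ - sP q a b c d - (sP q a b c d)⁻¹) / (1 - q) * F.1 (k + 1)) := by
  have hA := h.Acoef_mul_sq (k + 1)
  have hB := h.Bcoef_mul_sq (k + 1)
  have hrec := recurrence F (k + 1)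
  have e1 := h.apply_succ F.1 k
  have e2 := h.apply_succ F.1 (k + 1)
  have hx := h.x_ne (k + 1)
  have hs2 := sP_sq q a b c d
  have hs := h.sP_ne
  have hq := h.one_sub_qC_ne
  have hq0 := h.qC_ne
  have ha := h.a_ne
  have hb := h.b_ne
  have hc := h.c_ne
  have hd := h.d_ne
  have hxk : (z : ℂ) * (q : ℂ) ^ k = (z : ℂ) * (q : ℂ) ^ (k + 1) / q := by
    rw [zpow_add_one₀ hq0]
    field_simp
  rw [hxk] at e1
  rw [add_sub_cancel_right] at hrec
  simp only [Ccoef] at hrec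
  generalize dqIdx q z F.1 (k + 1) = G' at *
  generalize dqIdx q z F.1 k = G at *
  generalize (z : ℂ) * (q : ℂ) ^ (k + 1) = x at *
  generalize F.1 (k + 1 + 1) = f2 at *
  generalize F.1 (k + 1) = f1 at *
  generalize F.1 k = f0 at *
  generalize Acoef q a b c d (z * q ^ (k + 1)) = A at *
  generalize Bcoef q a b c d (z * q ^ (k + 1)) = B at *
  simp only [numer]
  generalize sP q a b c d = s at *
  have hf0 : f0 = f1 + (1 - q) * (x / q) * G := by linear_combination -e1
  subst e2 hf0
  have hconst : s⁻¹ * q / (a * b) = s / (c * d) := by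
    field_simp
    rw [hs2]
    field_simp
  have hmain : B * x ^ 2 * G' = A * x ^ 2 / q * G - x * ((μ - s - s⁻¹) / (1 - q) * f1) := by
    have : (1 - (q : ℂ)) * x * (B * x ^ 2 * G' -
        (A * x ^ 2 / q * G - x * ((μ - s - s⁻¹) / (1 - q) * f1))) = 0 := by
      have e : (1 - (q : ℂ)) * ((μ - s - s⁻¹) / (1 - q) * f1) = (μ - s - s⁻¹) * f1 := by
        field_simp
      linear_combination -(x ^ 2) * hrec + x ^ 2 * e
    exact sub_eq_zero.1 ((mul_eq_zero.1 this).resolve_left (mul_ne_zero hq hx))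
  rw [hA, hB] at hmain
  have hexp : s⁻¹ * (x - q / a) * (x - q / b) / q = x ^ 2 * (s⁻¹ / q) -
      x * s⁻¹ * (1 / a + 1 / b) + s / (c * d) := by
    rw [← hconst]
    field_simp
    ring
  have hexp2 : s * (x - 1 / c) * (x - 1 / d) = s * x ^ 2 - s * x * (1 / c + 1 / d) + s / (c * d) := by
    field_simp
    ring
  linear_combination hmain + G * hexp - G * hexp2

lemma exists_bound (h : Regular q z a b c d) (μ : ℂ) :
    ∃ K : ℝ, 0 ≤ K ∧ ∀ (F : Veig q a b c d z μ) (n : ℕ),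
      ‖((F.1 (n + 1), dqIdx q z F.1 (n + 1)) : ℂ × ℂ) - (F.1 n, dqIdx q z F.1 n)‖ ≤
        K * q ^ n * ‖((F.1 n, dqIdx q z F.1 n) : ℂ × ℂ)‖ := by
  have hx0 : Tendsto (fun n : ℕ => (z : ℂ) * (q : ℂ) ^ ((n : ℤ) + 1)) atTop (nhds 0) := by
    have hpow : Tendsto (fun n : ℕ => (q : ℂ) ^ n) atTop (nhds 0) := by
      refine tendsto_pow_atTop_nhds_zero_of_norm_lt_one ?_
      rw [Complex.norm_real, Real.norm_of_nonneg h.q_pos.le]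
      exact h.q_lt_one
    have := (hpow.mul_const (q : ℂ)).const_mul (z : ℂ)
    rw [zero_mul, mul_zero] at this
    refine this.congr fun n => ?_
    rw [zpow_add_one₀ h.qC_ne, zpow_natCast]
  obtain ⟨M₁, hM₁⟩ : ∃ M₁ : ℝ, ∀ n : ℕ, ‖(sP q a b c d *
      ((z : ℂ) * (q : ℂ) ^ ((n : ℤ) + 1) - 1 / c) *
        ((z : ℂ) * (q : ℂ) ^ ((n : ℤ) + 1) - 1 / d))⁻¹‖ ≤ M₁ := by
    have hlim := (((hx0.sub_const (1 / c)).const_mul (sP q a b c d)).mul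
      (hx0.sub_const (1 / d))).inv₀ (by
        have h1 := h.sP_ne
        have h2 := h.c_ne
        have h3 := h.d_ne
        simp [h1, h2, h3])
    obtain ⟨M, hM⟩ := hlim.norm.bddAbove_range
    exact ⟨M, fun n => hM ⟨n, rfl⟩⟩
  obtain ⟨M₂, hM₂⟩ : ∃ M₂ : ℝ, ∀ n : ℕ,
      ‖numer q a b c d ((z : ℂ) * (q : ℂ) ^ ((n : ℤ) + 1))‖ ≤ M₂ := by
    have hcont : Continuous (numer q a b c d) := by
      unfold numer
      fun_prop
    obtain ⟨M, hM⟩ := ((hcont.tendsto 0).comp hx0).norm.bddAbove_range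
    exact ⟨M, fun n => hM ⟨n, rfl⟩⟩
  set κ : ℂ := (μ - sP q a b c d - (sP q a b c d)⁻¹) / (1 - q)
  have hM₁0 : 0 ≤ M₁ := (norm_nonneg _).trans (hM₁ 0)
  have hM₂0 : 0 ≤ M₂ := (norm_nonneg _).trans (hM₂ 0)
  refine ⟨|z| + M₁ * |z| * (M₂ + ‖κ‖ * (1 + |z|)), by positivity, fun F n => ?_⟩
  set U : ℝ := ‖((F.1 n, dqIdx q z F.1 n) : ℂ × ℂ)‖
  have hF : ‖F.1 n‖ ≤ U := norm_fst_le ((F.1 n, dqIdx q z F.1 n) : ℂ × ℂ)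
  have hG : ‖dqIdx q z F.1 n‖ ≤ U := norm_snd_le ((F.1 n, dqIdx q z F.1 n) : ℂ × ℂ)
  have hU : 0 ≤ U := norm_nonneg _
  have hqn : (0 : ℝ) ≤ q ^ n := pow_nonneg h.q_pos.le n
  have hqn1 : q ^ n ≤ 1 := pow_le_one₀ h.q_pos.le h.q_lt_one.le
  have hnq : ‖(q : ℂ)‖ = q := by rw [Complex.norm_real, Real.norm_of_nonneg h.q_pos.le]
  have hnz : ‖(z : ℂ)‖ = |z| := by rw [Complex.norm_real, Real.norm_eq_abs]
  have hn1q : ‖(1 : ℂ) - q‖ ≤ 1 := by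
    have : (1 : ℂ) - q = ((1 - q : ℝ) : ℂ) := by push_cast; ring
    rw [this, Complex.norm_real, Real.norm_of_nonneg (sub_nonneg.2 h.q_lt_one.le)]
    linarith [h.q_pos]
  have hxn : ‖(z : ℂ) * (q : ℂ) ^ ((n : ℤ) + 1)‖ ≤ |z| * q ^ n := by
    rw [zpow_add_one₀ h.qC_ne, zpow_natCast, norm_mul, norm_mul, norm_pow, hnq, hnz]
    have := mul_le_of_le_one_right hqn h.q_lt_one.le
    gcongr
  have hdF : ‖F.1 (n + 1) - F.1 n‖ ≤ |z| * q ^ n * U := by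
    rw [h.apply_succ F.1 n, sub_sub_cancel_left, norm_neg, norm_mul, norm_mul, norm_mul,
      zpow_natCast, norm_pow, hnq, hnz]
    calc ‖(1 : ℂ) - q‖ * (|z| * q ^ n) * ‖dqIdx q z F.1 n‖ ≤ 1 * (|z| * q ^ n) * U := by gcongr
      _ = _ := by ring
  have hF1 : ‖F.1 (n + 1)‖ ≤ (1 + |z|) * U := by
    have h1 : ‖F.1 (n + 1)‖ ≤ ‖F.1 (n + 1) - F.1 n‖ + ‖F.1 n‖ := by
      simpa using norm_add_le (F.1 (n + 1) - F.1 n) (F.1 n)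
    have h2 : |z| * q ^ n * U ≤ |z| * 1 * U := by gcongr
    linarith
  have hdG : ‖dqIdx q z F.1 (n + 1) - dqIdx q z F.1 n‖ ≤
      M₁ * |z| * (M₂ + ‖κ‖ * (1 + |z|)) * q ^ n * U := by
    have h1 := h.dqIdx_succ_sub F n
    have h2 := h.Bcoef_mul_sq_ne (n + 1)
    rw [← eq_inv_mul_iff_mul_eq₀ h2] at h1
    rw [h1, norm_mul, norm_mul]
    have h3 : ‖numer q a b c d ((z : ℂ) * (q : ℂ) ^ ((n : ℤ) + 1)) * dqIdx q z F.1 n -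
        κ * F.1 (n + 1)‖ ≤ M₂ * U + ‖κ‖ * ((1 + |z|) * U) := by
      refine (norm_sub_le _ _).trans ?_
      rw [norm_mul, norm_mul]
      have := hM₂ n
      gcongr
    calc _ ≤ M₁ * (|z| * q ^ n * (M₂ * U + ‖κ‖ * ((1 + |z|) * U))) := by
          have := hM₁ n
          gcongr
      _ = _ := by ring
  have hz0 := abs_nonneg z
  rw [Prod.mk_sub_mk, Prod.norm_mk]
  refine max_le (hdF.trans ?_) (hdG.trans ?_)
  · have : 0 ≤ M₁ * |z| * (M₂ + ‖κ‖ * (1 + |z|)) * q ^ n * U := by positivity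
    linarith
  · have : 0 ≤ |z| * q ^ n * U := by positivity
    linarith

lemma exists_limit (h : Regular q z a b c d) {μ : ℂ} (F : Veig q a b c d z μ) :
    ∃ l : ℂ × ℂ, Tendsto (fun n : ℕ => ((F.1 n, dqIdx q z F.1 n) : ℂ × ℂ)) atTop (nhds l) ∧
      (l = 0 → F = 0) := by
  obtain ⟨K, hK, hbd⟩ := h.exists_bound μ
  obtain ⟨l, hl, hl0⟩ := exists_tendsto_of_norm_sub_le
    (u := fun n : ℕ => ((F.1 n, dqIdx q z F.1 n) : ℂ × ℂ)) h.q_pos h.q_lt_one hK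
    (fun n => by simpa using hbd F n)
  refine ⟨l, hl, fun h0 => ?_⟩
  obtain ⟨N, hN⟩ := hl0 h0
  have h1 : F.1 N = 0 := congrArg Prod.fst hN
  have h2 : dqIdx q z F.1 N = 0 := congrArg Prod.snd hN
  refine h.eq_zero_of_consecutive F h1 ?_
  rw [h.apply_succ F.1, h1, h2, mul_zero, sub_zero]

/-- Solutions on a half line are parametrized by their value and q-derivative at `0`. -/
lemma exists_limitEquiv (h : Regular q z a b c d) (μ : ℂ) :
    ∃ Λ : Veig q a b c d z μ ≃ₗ[ℂ] ℂ × ℂ, ∀ F,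
      Tendsto (fun n : ℕ => F.1 n) atTop (nhds (Λ F).1) ∧
        Tendsto (fun n : ℕ => dqIdx q z F.1 n) atTop (nhds (Λ F).2) := by
  choose l hl hl0 using fun F : Veig q a b c d z μ => h.exists_limit F
  let Λ : Veig q a b c d z μ →ₗ[ℂ] ℂ × ℂ :=
    { toFun := l
      map_add' := fun F G => by
        refine tendsto_nhds_unique (hl (F + G)) (((hl F).add (hl G)).congr fun n => ?_)
        refine Prod.ext rfl ?_
        simp only [dqIdx, Submodule.coe_add, Pi.add_apply, Prod.mk_add_mk]
        ring
      map_smul' := fun t F => by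
        refine tendsto_nhds_unique (hl (t • F)) (((hl F).const_smul t).congr fun n => ?_)
        refine Prod.ext rfl ?_
        simp only [dqIdx, Submodule.coe_smul, Pi.smul_apply, Prod.smul_mk, smul_eq_mul]
        ring }
  have hinj : Function.Injective Λ := by
    rw [← LinearMap.ker_eq_bot, LinearMap.ker_eq_bot']
    exact hl0
  have : FiniteDimensional ℂ (Veig q a b c d z μ) :=
    LinearEquiv.finiteDimensional (h.initialEquiv μ).symm
  refine ⟨LinearEquiv.ofInjectiveOfFinrankEq Λ hinj (h.initialEquiv μ).finrank_eq, fun F => ?_⟩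
  exact ⟨(continuous_fst.tendsto _).comp (hl F), (continuous_snd.tendsto _).comp (hl F)⟩

lemma rank_Veig (h : Regular q z a b c d) (μ : ℂ) : Module.rank ℂ (Veig q a b c d z μ) = 2 := by
  rw [(h.initialEquiv μ).rank_eq, rank_prod', Module.rank_self, one_add_one_eq_two]

end Regular

lemma memP.regular {q zm zp : ℝ} {a b c d : ℂ} (hq0 : 0 < q) (hq1 : q < 1) (hzm : zm < 0)
    (hzp : 0 < zp) (hP : memP q zm zp a b c d) :
    Regular q zm a b c d ∧ Regular q zp a b c d := by
  obtain ⟨ha, hb, hc, hd, -, h, -⟩ := hP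
  exact ⟨⟨hq0, hq1, hzm.ne, ha, hb, hc, hd, fun y hy k => (h y hy k).2⟩,
    ⟨hq0, hq1, hzp.ne', ha, hb, hc, hd, fun y hy k => (h y hy k).1⟩⟩

/-- for `γ` outside `S_pol`, `dim V_{μ(γ)} = 2` and restriction to each
half line is a linear isomorphism onto `V_{μ(γ)}^±`. -/
theorem statement9 (q zm zp : ℝ) (a b c d : ℂ)
    (hq0 : 0 < q) (hq1 : q < 1) (hzm : zm < 0) (hzp : 0 < zp)
    (hPg : memPgen q zm zp a b c d) (γ : ℂ) (hγ : γ ≠ 0)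
    (hpol : ∀ k : ℕ, γ ≠ sP q a b c d * (q : ℂ) ^ k ∧
      γ ≠ (sP q a b c d)⁻¹ * ((q : ℂ) ^ k)⁻¹) :
    Module.rank ℂ (Vfull q zm zp a b c d (γ + γ⁻¹)) = 2 ∧
    Function.Bijective (resPlus q zm zp a b c d (γ + γ⁻¹)) ∧
    Function.Bijective (resMinus q zm zp a b c d (γ + γ⁻¹)) := by
  obtain ⟨hm, hp⟩ := hPg.1.regular hq0 hq1 hzm hzp
  obtain ⟨Λm, hΛm⟩ := hm.exists_limitEquiv (γ + γ⁻¹)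
  obtain ⟨Λp, hΛp⟩ := hp.exists_limitEquiv (γ + γ⁻¹)
  have hglue : ∀ F : Vfull q zm zp a b c d (γ + γ⁻¹),
      Λm (resMinus q zm zp a b c d _ F) = Λp (resPlus q zm zp a b c d _ F) := by
    intro F
    obtain ⟨-, -, ⟨v, hv1, hv2⟩, ⟨v', hv1', hv2'⟩⟩ := F.2
    obtain ⟨h1, h2⟩ := hΛm (resMinus q zm zp a b c d _ F)
    obtain ⟨h3, h4⟩ := hΛp (resPlus q zm zp a b c d _ F)
    exact Prod.ext ((tendsto_nhds_unique h1 hv1).trans (tendsto_nhds_unique h3 hv2).symm)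
      ((tendsto_nhds_unique h2 hv1').trans (tendsto_nhds_unique h4 hv2').symm)
  have hext : ∀ (F : Veig q a b c d zm (γ + γ⁻¹)) (G : Veig q a b c d zp (γ + γ⁻¹)),
      Λm F = Λp G → (F.1, G.1) ∈ Vfull q zm zp a b c d (γ + γ⁻¹) := by
    intro F G h
    refine ⟨F.2, G.2, ⟨(Λm F).1, (hΛm F).1, ?_⟩, ⟨(Λm F).2, (hΛm F).2, ?_⟩⟩
    · rw [h]
      exact (hΛp G).1
    · rw [h]
      exact (hΛp G).2
  have heq : ∀ F G : Vfull q zm zp a b c d (γ + γ⁻¹),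
      resMinus q zm zp a b c d _ F = resMinus q zm zp a b c d _ G →
      resPlus q zm zp a b c d _ F = resPlus q zm zp a b c d _ G → F = G := fun F G h1 h2 =>
    Subtype.ext (Prod.ext (congrArg Subtype.val h1) (congrArg Subtype.val h2))
  have hplus : Function.Bijective (resPlus q zm zp a b c d (γ + γ⁻¹)) := by
    refine ⟨fun F G h => heq F G (Λm.injective ?_) h, fun G => ?_⟩
    · rw [hglue, hglue, h]
    · exact ⟨⟨_, hext (Λm.symm (Λp G)) G (Λm.apply_symm_apply _)⟩, rfl⟩
  have hminus : Function.Bijective (resMinus q zm zp a b c d (γ + γ⁻¹)) := by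
    refine ⟨fun F G h => heq F G h (Λp.injective ?_), fun F => ?_⟩
    · rw [← hglue, ← hglue, h]
    · exact ⟨⟨_, hext F (Λp.symm (Λm F)) (Λp.apply_symm_apply _).symm⟩, rfl⟩
  refine ⟨?_, hplus, hminus⟩
  rw [(LinearEquiv.ofBijective _ hplus).rank_eq, hp.rank_Veig]
end VVBQJ
end
end

section
/- Let (a,b,c,d) ∈ P_gen and let γ ∈ S_reg with γ ∉ {sq^k : k ∈ ℤ, k ≥ 0}. Then (γ − 1/γ)·K_{z₊}·( d_{z₋}(γ)·c_{z₊}(1/γ) + d_{z₋}†(γ)·c_{z₊}†(1/γ) ) = v(γ), where v(γ) = −[z₊(1−q)·θ(z₋/z₊) / θ(cz₋, dz₋, cz₊, dz₊)] · (cqγ/(as), dqγ/(as), cqγ/(bs), dqγ/(bs), sγ, qγ/s;q)_∞ · θ(absz₋z₊/(qγ)) / (γ·((qγ²;q)_∞)²). (This identity computes the Casorati determinant of the two asymptotic solutions Φ_γ⁺ and Φ_γ⁻.) -/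
open Complex Filter

noncomputable section

namespace VVBQJ

/-! ### The infinite `q`-shifted factorial -/

section Poch

variable {q : ℂ}

lemma summable_norm_mul_pow (hq : ‖q‖ < 1) (x : ℂ) : Summable fun j : ℕ => ‖-(x * q ^ j)‖ := by
  simpa using (summable_geometric_of_lt_one (norm_nonneg q) hq).mul_left ‖x‖

lemma multipliable_poch (hq : ‖q‖ < 1) (x : ℂ) : Multipliable fun j : ℕ => 1 - x * q ^ j := by
  simpa [sub_eq_add_neg] using multipliable_one_add_of_summable (summable_norm_mul_pow hq x)

lemma poch_ne_zero (hq : ‖q‖ < 1) {x : ℂ} (hx : ∀ j : ℕ, x * q ^ j ≠ 1) : poch q x ≠ 0 := by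
  have h := tprod_one_add_ne_zero_of_summable (f := fun j : ℕ => -(x * q ^ j))
    (fun j => by simpa [← sub_eq_add_neg, sub_eq_zero] using (hx j).symm)
    (summable_norm_mul_pow hq x)
  simpa [poch, sub_eq_add_neg] using h

lemma poch_eq_mul (hq : ‖q‖ < 1) (x : ℂ) : poch q x = (1 - x) * poch q (q * x) := by
  have h : (fun j : ℕ => 1 - x * q ^ (j + 1)) = fun j : ℕ => 1 - q * x * q ^ j := by
    ext j; ring
  unfold poch
  rw [tprod_eq_zero_mul' (by simpa only [h] using multipliable_poch hq (q * x)), h]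
  simp

lemma poch_one (hq : ‖q‖ < 1) : poch q 1 = 0 := by
  rw [poch_eq_mul hq]; simp

lemma tendsto_pochN (hq : ‖q‖ < 1) (x : ℂ) :
    Tendsto (pochN q x) atTop (nhds (poch q x)) :=
  (multipliable_poch hq x).hasProd.tendsto_prod_nat

lemma poch_eq_pochN_mul (hq : ‖q‖ < 1) (x : ℂ) (n : ℕ) :
    poch q x = pochN q x n * poch q (x * q ^ n) := by
  induction n with
  | zero => simp [pochN]
  | succ n ih =>
    rw [ih, poch_eq_mul hq (x * q ^ n), pochN, pochN, Finset.prod_range_succ]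
    ring_nf

end Poch

section IntegerPowers

variable {q : ℝ}

lemma norm_ofReal_lt_one (h0 : 0 < q) (h1 : q < 1) : ‖(q : ℂ)‖ < 1 := by
  simpa [abs_of_pos h0] using h1

lemma poch_zpow_eq_mul (h0 : 0 < q) (h1 : q < 1) (k : ℤ) :
    poch q ((q : ℂ) ^ k) = (1 - (q : ℂ) ^ k) * poch q ((q : ℂ) ^ (k + 1)) := by
  have hq : (q : ℂ) ≠ 0 := by exact_mod_cast h0.ne'
  rw [poch_eq_mul (norm_ofReal_lt_one h0 h1), zpow_add_one₀ hq, mul_comm (q : ℂ)]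

lemma poch_zpow_of_nonpos (h0 : 0 < q) (h1 : q < 1) {k : ℤ} (hk : k ≤ 0) :
    poch q ((q : ℂ) ^ k) = 0 := by
  have hq : (q : ℂ) ≠ 0 := by exact_mod_cast h0.ne'
  obtain ⟨n, rfl⟩ := Int.exists_eq_neg_ofNat hk
  rw [poch_eq_pochN_mul (norm_ofReal_lt_one h0 h1) _ n]
  simp [hq, poch_one (norm_ofReal_lt_one h0 h1)]

lemma norm_poch_zpow_le_one (h0 : 0 < q) (h1 : q < 1) (k : ℤ) :
    ‖poch q ((q : ℂ) ^ k)‖ ≤ 1 := by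
  rcases le_or_gt k 0 with hk | hk
  · simp [poch_zpow_of_nonpos h0 h1 hk]
  · obtain ⟨n, rfl⟩ := Int.eq_ofNat_of_zero_le hk.le
    refine le_of_tendsto (tendsto_pochN (norm_ofReal_lt_one h0 h1) _).norm
      (Eventually.of_forall fun N => ?_)
    rw [pochN, norm_prod]
    refine Finset.prod_le_one (fun _ _ => norm_nonneg _) fun j _ => ?_
    have h : (1 : ℂ) - (q : ℂ) ^ (n : ℤ) * (q : ℂ) ^ j = ((1 - q ^ (n + j) : ℝ) : ℂ) := by
      push_cast [pow_add]; simp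
    rw [h, Complex.norm_real, Real.norm_eq_abs, abs_le]
    have h2 : 0 < q ^ (n + j) := by positivity
    have h3 : q ^ (n + j) ≤ 1 := pow_le_one₀ h0.le h1.le
    constructor <;> linarith

lemma poch_self_ne_zero (h0 : 0 < q) (h1 : q < 1) : poch (q : ℂ) q ≠ 0 := by
  refine poch_ne_zero (norm_ofReal_lt_one h0 h1) fun j h => ?_
  have : q ^ (j + 1) = 1 := by
    rw [pow_succ']; exact_mod_cast h
  exact (pow_lt_one₀ h0.le h1 (Nat.succ_ne_zero j)).ne this

lemma tendsto_poch_zpow (h0 : 0 < q) (h1 : q < 1) (k : ℤ) :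
    Tendsto (fun N : ℕ => poch q ((q : ℂ) ^ (k + N))) atTop (nhds 1) := by
  have hq : (q : ℂ) ≠ 0 := by exact_mod_cast h0.ne'
  have hn := norm_ofReal_lt_one h0 h1
  have hE := poch_self_ne_zero h0 h1
  have key : Tendsto (fun N : ℕ => poch q ((q : ℂ) ^ (N + 1))) atTop (nhds 1) := by
    have h := (tendsto_pochN hn (q : ℂ)).inv₀ hE |>.const_mul (poch (q : ℂ) q)
    rw [mul_inv_cancel₀ hE] at h
    refine h.congr fun N => ?_
    have h2 := poch_eq_pochN_mul hn (q : ℂ) N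
    have h3 : pochN (q : ℂ) q N ≠ 0 := by
      intro h4; rw [h4, zero_mul] at h2; exact hE h2
    rw [pow_succ', h2]
    field_simp
  have key2 : Tendsto (fun N : ℕ => (k + N - 1).toNat) atTop atTop := by
    refine tendsto_atTop_atTop.2 fun m => ⟨(m + 1 - k).toNat, fun N hN => ?_⟩
    omega
  refine (key.comp key2).congr' ?_
  filter_upwards [eventually_ge_atTop (1 - k).toNat] with N hN
  have h4 : k + N = (((k + N - 1).toNat + 1 : ℕ) : ℤ) := by omega
  rw [Function.comp_apply, h4, zpow_natCast]
  simp only [← h4]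

end IntegerPowers

/-! ### The theta series and Jacobi's triple product -/

/-- The general term of the bilateral theta series. -/
def thetaTerm (q x : ℂ) (n : ℤ) : ℂ := q ^ (n * (n - 1) / 2) * x ^ n

/-- The bilateral theta series `∑ q^(n(n-1)/2) xⁿ`. -/
def thetaSeries (q x : ℂ) : ℂ := ∑' n : ℤ, thetaTerm q x n

section ThetaSeries

variable {q x : ℂ}

lemma two_mul_choose_two (n : ℤ) : 2 * (n * (n - 1) / 2) = n * (n - 1) :=
  Int.mul_ediv_cancel' (Int.even_mul_pred_self n).two_dvd

lemma thetaTerm_add_one (hq : q ≠ 0) (hx : x ≠ 0) (n : ℤ) :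
    thetaTerm q x (n + 1) = x * (q ^ n * thetaTerm q x n) := by
  have h : (n + 1) * (n + 1 - 1) / 2 = n + n * (n - 1) / 2 := by
    have h1 := two_mul_choose_two n
    have h2 := two_mul_choose_two (n + 1)
    have h3 : (n + 1) * (n + 1 - 1) = 2 * n + n * (n - 1) := by ring
    omega
  rw [thetaTerm, thetaTerm, h, zpow_add₀ hq, zpow_add_one₀ hx]
  ring

lemma thetaTerm_mul (q y x : ℂ) (n : ℤ) : thetaTerm q (y * x) n = y ^ n * thetaTerm q x n := by
  rw [thetaTerm, thetaTerm, mul_zpow]; ring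

lemma thetaTerm_ne_zero (hq : q ≠ 0) (hx : x ≠ 0) (n : ℤ) : thetaTerm q x n ≠ 0 :=
  mul_ne_zero (zpow_ne_zero _ hq) (zpow_ne_zero _ hx)

lemma summable_thetaTerm_nat (hq0 : q ≠ 0) (hq : ‖q‖ < 1) (hx : x ≠ 0) :
    Summable fun n : ℕ => ‖thetaTerm q x n‖ := by
  refine summable_of_ratio_test_tendsto_lt_one zero_lt_one
    (Eventually.of_forall fun n => norm_ne_zero_iff.2 (thetaTerm_ne_zero hq0 hx n)) ?_
  have h : Tendsto (fun n : ℕ => ‖x‖ * ‖q‖ ^ n) atTop (nhds 0) := by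
    simpa using (tendsto_pow_atTop_nhds_zero_of_lt_one (norm_nonneg q) hq).const_mul ‖x‖
  refine h.congr fun n => ?_
  have h2 := norm_ne_zero_iff.2 (thetaTerm_ne_zero hq0 hx n)
  rw [Nat.cast_add_one, thetaTerm_add_one hq0 hx]
  simp only [norm_norm, norm_mul, zpow_natCast, norm_pow]
  field_simp

lemma thetaTerm_neg (hq : q ≠ 0) (x : ℂ) (n : ℤ) : thetaTerm q x (-n) = thetaTerm q (q / x) n := by
  have h : (-n) * (-n - 1) / 2 = n + n * (n - 1) / 2 := by
    have h1 := two_mul_choose_two n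
    have h2 := two_mul_choose_two (-n)
    have h3 : (-n) * (-n - 1) = 2 * n + n * (n - 1) := by ring
    omega
  rw [thetaTerm, thetaTerm, h, zpow_add₀ hq, div_zpow, zpow_neg]
  ring

lemma summable_norm_thetaTerm (hq0 : q ≠ 0) (hq : ‖q‖ < 1) (hx : x ≠ 0) :
    Summable fun n : ℤ => ‖thetaTerm q x n‖ := by
  refine Summable.of_nat_of_neg (summable_thetaTerm_nat hq0 hq hx) ?_
  simpa only [thetaTerm_neg hq0] using summable_thetaTerm_nat hq0 hq (div_ne_zero hq0 hx)

lemma thetaSeries_mul_base (hq : q ≠ 0) (hx : x ≠ 0) :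
    x * thetaSeries q (q * x) = thetaSeries q x := by
  rw [thetaSeries, thetaSeries, ← tsum_mul_left,
    ← (Equiv.addRight (1 : ℤ)).tsum_eq (thetaTerm q x)]
  simp only [Equiv.coe_addRight, thetaTerm_add_one hq hx, thetaTerm_mul]

end ThetaSeries

/-- The sum `∑ q^(n(n-1)/2) (-x)ⁿ (q^(n+1+N);q)_∞` interpolating between `(q,x;q)_∞` and the
theta series. -/
def thetaInterp (q x : ℂ) (N : ℤ) : ℂ :=
  ∑' n : ℤ, thetaTerm q (-x) n * poch q (q ^ (n + 1 + N))

section TripleProduct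

variable {q : ℝ} {x : ℂ}

lemma norm_thetaTerm_mul_poch_le (h0 : 0 < q) (h1 : q < 1) (y : ℂ) (n k : ℤ) :
    ‖thetaTerm q y n * poch q ((q : ℂ) ^ k)‖ ≤ ‖thetaTerm q y n‖ := by
  rw [norm_mul]
  exact mul_le_of_le_one_right (norm_nonneg _) (norm_poch_zpow_le_one h0 h1 k)

lemma summable_thetaInterp (h0 : 0 < q) (h1 : q < 1) (hx : x ≠ 0) (N : ℤ) :
    Summable fun n : ℤ => thetaTerm q (-x) n * poch q ((q : ℂ) ^ (n + 1 + N)) :=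
  (summable_norm_thetaTerm (by exact_mod_cast h0.ne') (norm_ofReal_lt_one h0 h1)
    (neg_ne_zero.2 hx)).of_norm_bounded fun n => norm_thetaTerm_mul_poch_le h0 h1 _ n _

lemma thetaInterp_eq_neg_mul (h0 : 0 < q) (hx : x ≠ 0) (N : ℤ) :
    thetaInterp q x N = -x * thetaInterp q (q * x) (N + 1) := by
  have hq : (q : ℂ) ≠ 0 := by exact_mod_cast h0.ne'
  rw [thetaInterp, thetaInterp, ← tsum_mul_left, ← (Equiv.addRight (1 : ℤ)).tsum_eq]
  refine tsum_congr fun n => ?_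
  rw [Equiv.coe_addRight, thetaTerm_add_one hq (neg_ne_zero.2 hx), ← mul_neg, thetaTerm_mul,
    show n + 1 + 1 + N = n + 1 + (N + 1) by ring]
  ring

lemma thetaInterp_add_one (h0 : 0 < q) (h1 : q < 1) (hx : x ≠ 0) (N : ℤ) :
    thetaInterp q x (N + 1) = (1 - (q : ℂ) ^ (N + 1) / x) * thetaInterp q x N := by
  have hq : (q : ℂ) ≠ 0 := by exact_mod_cast h0.ne'
  have key : thetaInterp q x N =
      thetaInterp q x (N + 1) - (q : ℂ) ^ (N + 1) * thetaInterp q (q * x) (N + 1) := by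
    simp only [thetaInterp]
    rw [← tsum_mul_left, ← (summable_thetaInterp h0 h1 hx _).tsum_sub
      ((summable_thetaInterp h0 h1 (mul_ne_zero hq hx) _).mul_left _)]
    refine tsum_congr fun n => ?_
    rw [← mul_neg, thetaTerm_mul, poch_zpow_eq_mul h0 h1, ← add_assoc,
      show n + 1 + N = N + 1 + n by ring, zpow_add₀ hq (N + 1) n]
    ring
  have h2 := thetaInterp_eq_neg_mul h0 hx N
  field_simp
  linear_combination (-x) * key + (q : ℂ) ^ (N + 1) * h2

lemma thetaInterp_natCast (h0 : 0 < q) (h1 : q < 1) (hx : x ≠ 0) (N : ℕ) :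
    thetaInterp q x N = pochN q (q / x) N * thetaInterp q x 0 := by
  induction N with
  | zero => simp [pochN]
  | succ N ih =>
    have hq : (q : ℂ) ≠ 0 := by exact_mod_cast h0.ne'
    rw [Nat.cast_add_one, thetaInterp_add_one h0 h1 hx, ih, pochN, pochN,
      Finset.prod_range_succ, zpow_add_one₀ hq, zpow_natCast]
    ring

lemma thetaSeries_neg_eq (h0 : 0 < q) (h1 : q < 1) (hx : x ≠ 0) :
    thetaSeries q (-x) = poch q (q / x) * thetaInterp q x 0 := by
  have hq : (q : ℂ) ≠ 0 := by exact_mod_cast h0.ne'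
  have hn := norm_ofReal_lt_one h0 h1
  have hlim : Tendsto (fun N : ℕ => thetaInterp q x N) atTop (nhds (thetaSeries q (-x))) := by
    refine tendsto_tsum_of_dominated_convergence
      (summable_norm_thetaTerm hq hn (neg_ne_zero.2 hx)) (fun n => ?_)
      (Eventually.of_forall fun N n => norm_thetaTerm_mul_poch_le h0 h1 _ n _)
    simpa using (tendsto_poch_zpow h0 h1 (n + 1)).const_mul (thetaTerm q (-x) n)
  refine tendsto_nhds_unique hlim ?_
  simp only [thetaInterp_natCast h0 h1 hx]
  exact (tendsto_pochN hn _).mul_const _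

lemma thetaInterp_zero_eq_pochN_mul (h0 : 0 < q) (h1 : q < 1) (hx : x ≠ 0) (N : ℕ) :
    thetaInterp q x 0 = pochN q x N * thetaInterp q ((q : ℂ) ^ N * x) 0 := by
  have hq : (q : ℂ) ≠ 0 := by exact_mod_cast h0.ne'
  induction N with
  | zero => simp [pochN]
  | succ N ih =>
    have hy : (q : ℂ) ^ N * x ≠ 0 := mul_ne_zero (pow_ne_zero _ hq) hx
    have h2 := thetaInterp_eq_neg_mul h0 hy 0
    rw [thetaInterp_add_one h0 h1 (mul_ne_zero hq hy), zero_add, zpow_one] at h2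
    rw [ih, h2, pochN, pochN, Finset.prod_range_succ, pow_succ' (q : ℂ) N, ← mul_assoc (q : ℂ)]
    field_simp
    ring

lemma thetaInterp_zero (h0 : 0 < q) (h1 : q < 1) (hx : x ≠ 0) :
    thetaInterp q x 0 = poch q x * poch q q := by
  have hq : (q : ℂ) ≠ 0 := by exact_mod_cast h0.ne'
  have hn := norm_ofReal_lt_one h0 h1
  have hlim : Tendsto (fun N : ℕ => thetaInterp q ((q : ℂ) ^ N * x) 0) atTop
      (nhds (∑' n : ℤ, if n = 0 then poch (q : ℂ) q else 0)) := by
    refine tendsto_tsum_of_dominated_convergence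
      (summable_norm_thetaTerm hq hn (neg_ne_zero.2 hx)) (fun n => ?_)
      (Eventually.of_forall fun N n => ?_)
    · rcases lt_trichotomy n 0 with hneg | rfl | hpos
      · simp [poch_zpow_of_nonpos h0 h1 (show n + 1 ≤ 0 by omega), hneg.ne]
      · simp [thetaTerm]
      · obtain ⟨m, rfl⟩ := Int.eq_ofNat_of_zero_le hpos.le
        have hm : m ≠ 0 := by rintro rfl; simp at hpos
        have h2 : Tendsto (fun N : ℕ => ((q : ℂ) ^ N) ^ m) atTop (nhds 0) := by
          simpa [hm] using (tendsto_pow_atTop_nhds_zero_of_norm_lt_one hn).pow m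
        simp only [← mul_neg, thetaTerm_mul, zpow_natCast, hpos.ne', if_false]
        simpa only [zero_mul] using (h2.mul_const _).mul_const _
    · rcases le_or_gt 0 n with hn0 | hneg
      · refine (norm_thetaTerm_mul_poch_le h0 h1 _ n _).trans ?_
        obtain ⟨m, rfl⟩ := Int.eq_ofNat_of_zero_le hn0
        rw [← mul_neg, thetaTerm_mul, norm_mul, zpow_natCast, norm_pow, norm_pow]
        exact mul_le_of_le_one_left (norm_nonneg _)
          (pow_le_one₀ (by positivity) (pow_le_one₀ (norm_nonneg _) hn.le))
      · simp [poch_zpow_of_nonpos h0 h1 (show n + 1 ≤ 0 by omega)]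
  rw [tsum_ite_eq] at hlim
  refine tendsto_nhds_unique ?_ ((tendsto_pochN hn x).mul hlim)
  simp only [← thetaInterp_zero_eq_pochN_mul h0 h1 hx, tendsto_const_nhds]

/-- Jacobi's triple product identity. -/
lemma thetaSeries_neg_eq_theta (h0 : 0 < q) (h1 : q < 1) (hx : x ≠ 0) :
    thetaSeries q (-x) = poch q q * theta q x := by
  rw [thetaSeries_neg_eq h0 h1 hx, thetaInterp_zero h0 h1 hx, theta]
  ring

end TripleProduct

/-! ### The three-term theta relation -/

section ThreeTerm

/-- The bijection of `ℤ²` splitting pairs according to the parity of the sum of the entries. -/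
lemma bijective_parity_split : Function.Bijective
    (Sum.elim (fun t : ℤ × ℤ => (t.1 + t.2, t.1 - t.2))
      (fun t : ℤ × ℤ => (t.1 + t.2 + 1, t.1 - t.2))) := by
  constructor
  · rintro (⟨k, l⟩ | ⟨k, l⟩) (⟨k', l'⟩ | ⟨k', l'⟩) h <;>
      simp only [Sum.elim_inl, Sum.elim_inr, Prod.mk.injEq, Sum.inl.injEq, Sum.inr.injEq,
        reduceCtorEq] at h ⊢ <;> omega
  · rintro ⟨m, n⟩
    rcases Int.even_or_odd' (m + n) with ⟨k, hk | hk⟩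
    · exact ⟨Sum.inl (k, m - k), by simp only [Sum.elim_inl, Prod.mk.injEq]; omega⟩
    · exact ⟨Sum.inr (k, m - k - 1), by simp only [Sum.elim_inr, Prod.mk.injEq]; omega⟩

variable {q p r : ℂ}

lemma thetaTerm_mul_thetaTerm_even (hq : q ≠ 0) (hp : p ≠ 0) (hr : r ≠ 0) (k l : ℤ) :
    thetaTerm q (-p) (k + l) * thetaTerm q (-r) (k - l) =
      thetaTerm (q ^ 2) (p * r) k * thetaTerm (q ^ 2) (q * (p / r)) l := by
  have hexp : (k + l) * (k + l - 1) / 2 + (k - l) * (k - l - 1) / 2 =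
      2 * (k * (k - 1) / 2) + 2 * (l * (l - 1) / 2) + l := by
    linarith [two_mul_choose_two k, two_mul_choose_two l, two_mul_choose_two (k + l),
      two_mul_choose_two (k - l)]
  have hpow : q ^ ((k + l) * (k + l - 1) / 2) * q ^ ((k - l) * (k - l - 1) / 2) =
      (q ^ 2) ^ (k * (k - 1) / 2) * (q ^ 2) ^ (l * (l - 1) / 2) * q ^ l := by
    rw [← zpow_add₀ hq, hexp, zpow_add₀ hq, zpow_add₀ hq, zpow_mul, zpow_mul]
    norm_cast
  have hneg : (-p) ^ (k + l) * (-r) ^ (k - l) = (p * r) ^ k * (p / r) ^ l := by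
    rw [zpow_add₀ (neg_ne_zero.2 hp), zpow_sub₀ (neg_ne_zero.2 hr), ← neg_mul_neg p r,
      ← neg_div_neg_eq p r, mul_zpow, div_zpow]
    ring
  simp only [thetaTerm, mul_zpow q]
  linear_combination ((-p) ^ (k + l) * (-r) ^ (k - l)) * hpow +
    ((q ^ 2) ^ (k * (k - 1) / 2) * (q ^ 2) ^ (l * (l - 1) / 2) * q ^ l) * hneg

lemma thetaTerm_mul_thetaTerm_odd (hq : q ≠ 0) (hp : p ≠ 0) (hr : r ≠ 0) (k l : ℤ) :
    thetaTerm q (-p) (k + l + 1) * thetaTerm q (-r) (k - l) =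
      -p * (thetaTerm (q ^ 2) (q * (p * r)) k * thetaTerm (q ^ 2) (q ^ 2 * (p / r)) l) := by
  have h := thetaTerm_mul_thetaTerm_even hq hp hr k l
  rw [thetaTerm_add_one hq (neg_ne_zero.2 hp), mul_assoc, mul_assoc, h, zpow_add₀ hq]
  simp only [thetaTerm_mul]
  rw [show (q ^ 2) ^ l = q ^ l * q ^ l by rw [sq, mul_zpow]]
  ring

lemma thetaSeries_neg_mul (hq0 : q ≠ 0) (hq : ‖q‖ < 1) (hp : p ≠ 0) (hr : r ≠ 0) :
    thetaSeries q (-p) * thetaSeries q (-r) =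
      thetaSeries (q ^ 2) (p * r) * thetaSeries (q ^ 2) (q * (p / r)) -
        r * (thetaSeries (q ^ 2) (p / r) * thetaSeries (q ^ 2) (q * (p * r))) := by
  have hq0' : q ^ 2 ≠ 0 := pow_ne_zero 2 hq0
  have hq' : ‖q ^ 2‖ < 1 := by
    rw [norm_pow]; exact pow_lt_one₀ (norm_nonneg _) hq two_ne_zero
  have hS : ∀ {x : ℂ}, x ≠ 0 → Summable fun n : ℤ => ‖thetaTerm (q ^ 2) x n‖ :=
    fun hx => summable_norm_thetaTerm hq0' hq' hx
  have hpr := mul_ne_zero hp hr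
  have hpr' := div_ne_zero hp hr
  have h1 := hS hpr
  have h2 := hS (mul_ne_zero hq0 hpr')
  have h3 := hS (mul_ne_zero hq0 hpr)
  have h4 := hS (mul_ne_zero hq0' hpr')
  have hbase := thetaSeries_mul_base hq0' hpr'
  have hodd : -p * (thetaSeries (q ^ 2) (q * (p * r)) * thetaSeries (q ^ 2) (q ^ 2 * (p / r))) =
      -(r * (thetaSeries (q ^ 2) (p / r) * thetaSeries (q ^ 2) (q * (p * r)))) := by
    rw [← hbase]; field_simp
  rw [sub_eq_add_neg, ← hodd]
  simp only [thetaSeries]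
  rw [tsum_mul_tsum_of_summable_norm (summable_norm_thetaTerm hq0 hq (neg_ne_zero.2 hp))
      (summable_norm_thetaTerm hq0 hq (neg_ne_zero.2 hr)),
    tsum_mul_tsum_of_summable_norm h1 h2, tsum_mul_tsum_of_summable_norm h3 h4,
    ← tsum_mul_left, ← (Equiv.ofBijective _ bijective_parity_split).tsum_eq, Summable.tsum_sum]
  · simp [thetaTerm_mul_thetaTerm_even hq0 hp hr, thetaTerm_mul_thetaTerm_odd hq0 hp hr]
  · refine (summable_mul_of_summable_norm h1 h2).congr fun t => ?_
    simp [thetaTerm_mul_thetaTerm_even hq0 hp hr]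
  · refine ((summable_mul_of_summable_norm h3 h4).mul_left (-p)).congr fun t => ?_
    simp [thetaTerm_mul_thetaTerm_odd hq0 hp hr]

end ThreeTerm

section Theta

variable {q : ℝ} {x : ℂ}

/-- The Weierstrass–Riemann three-term relation for theta functions. -/
lemma theta_three_term (h0 : 0 < q) (h1 : q < 1) {a b t w z : ℂ} (ha : a ≠ 0) (hb : b ≠ 0)
    (ht : t ≠ 0) (hw : w ≠ 0) (hz : z ≠ 0) :
    theta q (a * w) * theta q (b * z) * theta q (b * t * w) * theta q (a * t * z) -
        theta q (b * w) * theta q (a * z) * theta q (a * t * w) * theta q (b * t * z) =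
      -(b * z) * (theta q (a / b) * theta q (w / z) * theta q t * theta q (a * b * t * w * z)) := by
  have hq : (q : ℂ) ≠ 0 := by exact_mod_cast h0.ne'
  have hE := poch_self_ne_zero h0 h1
  have key : ∀ {p r X Y : ℂ}, p ≠ 0 → r ≠ 0 → p * r = X → p / r = Y →
      poch q q ^ 2 * (theta q p * theta q r) =
        thetaSeries (q ^ 2) X * thetaSeries (q ^ 2) (q * Y) -
          r * (thetaSeries (q ^ 2) Y * thetaSeries (q ^ 2) (q * X)) := by
    rintro p r _ _ hp hr rfl rfl
    rw [← thetaSeries_neg_mul hq (norm_ofReal_lt_one h0 h1) hp hr,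
      thetaSeries_neg_eq_theta h0 h1 hp, thetaSeries_neg_eq_theta h0 h1 hr]
    ring
  have e1 := key (p := b * t * w) (r := a * w) (X := a * b * t * w ^ 2) (Y := b * t / a)
    (by simp [*]) (by simp [*]) (by ring) (by field_simp)
  have e2 := key (p := a * t * z) (r := b * z) (X := a * b * t * z ^ 2) (Y := a * t / b)
    (by simp [*]) (by simp [*]) (by ring) (by field_simp)
  have e3 := key (p := a * t * w) (r := b * w) (X := a * b * t * w ^ 2) (Y := a * t / b)
    (by simp [*]) (by simp [*]) (by ring) (by field_simp)
  have e4 := key (p := b * t * z) (r := a * z) (X := a * b * t * z ^ 2) (Y := b * t / a)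
    (by simp [*]) (by simp [*]) (by ring) (by field_simp)
  have e5 := key (p := a * b * t * w * z) (r := w / z) (X := a * b * t * w ^ 2)
    (Y := a * b * t * z ^ 2) (by simp [*]) (by simp [*]) (by field_simp) (by field_simp)
  have e6 := key (p := t) (r := a / b) (X := a * t / b) (Y := b * t / a)
    ht (by simp [*]) (by ring) (by field_simp)
  refine mul_left_cancel₀ (pow_ne_zero 4 hE) ?_
  calc _ = poch q q ^ 2 * (theta q (b * t * w) * theta q (a * w)) *
          (poch q q ^ 2 * (theta q (a * t * z) * theta q (b * z))) -
        poch q q ^ 2 * (theta q (a * t * w) * theta q (b * w)) *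
          (poch q q ^ 2 * (theta q (b * t * z) * theta q (a * z))) := by ring
    _ = -(b * z) * (poch q q ^ 2 * (theta q t * theta q (a / b)) *
          (poch q q ^ 2 * (theta q (a * b * t * w * z) * theta q (w / z)))) := by
        rw [e1, e2, e3, e4, e5, e6]
        field_simp
        ring
    _ = _ := by ring

lemma theta_inv (h0 : 0 < q) (h1 : q < 1) (hx : x ≠ 0) : theta q x⁻¹ = -x⁻¹ * theta q x := by
  have hn := norm_ofReal_lt_one h0 h1
  rw [theta, theta, poch_eq_mul hn x⁻¹, poch_eq_mul hn x, div_inv_eq_mul, ← div_eq_mul_inv]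
  field_simp
  ring

lemma theta_div_base (h0 : 0 < q) (h1 : q < 1) (hx : x ≠ 0) :
    theta q (x / q) = -(x / q) * theta q x := by
  have hq : (q : ℂ) ≠ 0 := by exact_mod_cast h0.ne'
  have h := theta_inv h0 h1 (div_ne_zero hq hx)
  rw [inv_div] at h
  rw [h, theta, theta, div_div_cancel₀ hq]
  ring

lemma poch_ne_zero_of_zpow (h0 : 0 < q) (h1 : q < 1) (hx : ∀ k : ℤ, x ≠ (q : ℂ) ^ k) :
    poch q x ≠ 0 := by
  have hq : (q : ℂ) ≠ 0 := by exact_mod_cast h0.ne'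
  refine poch_ne_zero (norm_ofReal_lt_one h0 h1) fun j hj => hx (-j) ?_
  rw [zpow_neg, zpow_natCast]
  exact eq_inv_of_mul_eq_one_left hj

lemma base_mul_ne_zpow (h0 : 0 < q) (hx : ∀ k : ℤ, x ≠ (q : ℂ) ^ k) (k : ℤ) :
    (q : ℂ) * x ≠ (q : ℂ) ^ k := by
  have hq : (q : ℂ) ≠ 0 := by exact_mod_cast h0.ne'
  intro h
  refine hx (k - 1) ?_
  rw [zpow_sub_one₀ hq, ← h]
  field_simp

lemma inv_ne_zpow (hx : ∀ k : ℤ, x ≠ (q : ℂ) ^ k) (k : ℤ) : x⁻¹ ≠ (q : ℂ) ^ k :=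
  fun h => hx (-k) (by rw [zpow_neg, ← h, inv_inv])

lemma theta_ne_zero (h0 : 0 < q) (h1 : q < 1) (hx : ∀ k : ℤ, x ≠ (q : ℂ) ^ k) :
    theta q x ≠ 0 :=
  mul_ne_zero (poch_ne_zero_of_zpow h0 h1 hx)
    (poch_ne_zero_of_zpow h0 h1 (by
      simpa only [div_eq_mul_inv] using base_mul_ne_zpow h0 (inv_ne_zpow hx)))

end Theta

/-! ### Non-degeneracy of the parameters -/

section Parameters

variable {q : ℝ}

lemma inv_div_inv_ne_zpow (h0 : 0 < q) (h1 : q < 1) {M x y : ℝ} (hM : 0 < M) (hx : M < x)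
    (hxy : x < y) (hy : y < M / q) (k : ℤ) : y / x ≠ q ^ k := by
  intro h
  have hx0 : 0 < x := hM.trans hx
  rcases le_or_gt 0 k with hk | hk
  · have h2 : y / x ≤ 1 := h ▸ zpow_le_one₀ h0 h1.le hk
    rw [div_le_one hx0] at h2
    linarith
  · have h2 : q ^ (-1 : ℤ) ≤ y / x := h ▸ zpow_le_zpow_right_of_le_one₀ h0 h1.le (by omega)
    rw [zpow_neg_one, le_div_iff₀ hx0, inv_mul_eq_div] at h2
    have h3 : M / q < x / q := div_lt_div_of_pos_right hx h0
    linarith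

lemma pairCond.div_ne_zpow {zm zp : ℝ} {a b : ℂ} (h : pairCond q zm zp a b)
    (h0 : 0 < q) (h1 : q < 1) (hzm : zm < 0) (hzp : 0 < zp) (hb : b ≠ 0) (hab : a ≠ b) (k : ℤ) :
    a / b ≠ (q : ℂ) ^ k := by
  intro hk
  rcases h with h | ⟨A, B, k₀, rfl, rfl, hB, hBA, hA⟩ | ⟨A, B, k₀, rfl, rfl, hA, hAB, hB⟩
  · have hn : (1 : ℝ) = q ^ k := by
      have h2 := congrArg norm hk
      rwa [norm_div, norm_zpow, h, RCLike.norm_conj, div_self (norm_ne_zero_iff.2 hb),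
        Complex.norm_real, Real.norm_eq_abs, abs_of_pos h0] at h2
    have hn' : (q : ℂ) ^ k = 1 := by exact_mod_cast hn.symm
    rw [hn', div_eq_one_iff_eq hb] at hk
    exact hab hk
  · have hk' : A / B = q ^ k := by exact_mod_cast hk
    refine inv_div_inv_ne_zpow h0 h1 (by positivity) hB hBA
      (by rwa [mul_div_assoc, div_eq_mul_inv (q ^ k₀), ← zpow_sub_one₀ h0.ne']) (-k) ?_
    rw [zpow_neg, ← hk', inv_div, one_div, one_div, inv_div_inv]
  · have hk' : A / B = q ^ k := by exact_mod_cast hk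
    refine inv_div_inv_ne_zpow h0 h1 (M := -(zm * q ^ k₀)) (x := -(1 / B)) (y := -(1 / A))
      (by have := mul_pos_of_neg_of_neg hzm (neg_lt_zero.2 (zpow_pos h0 k₀)); linarith)
      (by linarith) (by linarith) ?_ (-k) ?_
    · rw [neg_div, mul_div_assoc, div_eq_mul_inv (q ^ k₀), ← zpow_sub_one₀ h0.ne']
      linarith
    · rw [zpow_neg, ← hk', inv_div, neg_div_neg_eq, one_div, one_div, inv_div_inv]

lemma mul_ne_zpow_of_ne_inv_mul {x : ℂ} {z : ℝ} (hz : z ≠ 0) {k : ℤ}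
    (h : x ≠ (z : ℂ)⁻¹ * (q : ℂ) ^ k) : x * z ≠ (q : ℂ) ^ k := by
  have hz' : (z : ℂ) ≠ 0 := by exact_mod_cast hz
  intro h2
  apply h
  rw [← h2]
  field_simp

lemma Sreg.sq_ne_zpow {γ : ℂ} (h0 : 0 < q) (hγ : Sreg q γ) (k : ℤ) : γ ^ 2 ≠ (q : ℂ) ^ k := by
  intro h
  have h2 : γ ^ 2 = ((q ^ ((k : ℝ) / 2) : ℝ) : ℂ) ^ 2 := by
    rw [h, ← Complex.ofReal_pow, ← Real.rpow_natCast, ← Real.rpow_mul h0.le]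
    simp
  rcases sq_eq_sq_iff_eq_or_eq_neg.1 h2 with h3 | h3
  · exact (hγ.2 k).1 h3
  · exact (hγ.2 k).2 h3

lemma sP_comm (q : ℝ) (a b c d : ℂ) : sP q b a c d = sP q a b c d := by
  rw [sP, sP, mul_comm b a]

lemma sP_ne_zero (h0 : 0 < q) {a b c d : ℂ} (ha : a ≠ 0) (hb : b ≠ 0) (hc : c ≠ 0) (hd : d ≠ 0) :
    sP q a b c d ≠ 0 := by
  have hq : (q : ℂ) ≠ 0 := by exact_mod_cast h0.ne'
  simp [sP, Complex.cpow_eq_zero_iff, *]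

lemma dz_mul_cz_inv (h0 : 0 < q) (h1 : q < 1) {w z : ℝ} {a b c d γ : ℂ} (ha : a ≠ 0)
    (hw : w ≠ 0) (hγ : γ ≠ 0) (hs : sP q a b c d ≠ 0)
    (hca : poch q (c * q / a) ≠ 0) (hda : poch q (d * q / a) ≠ 0) :
    dz q a b c d w γ * cz q a b c d z γ⁻¹ =
      -(a * (sP q a b c d / γ) * w / q) *
        (poch q (c * q * γ / (a * sP q a b c d)) * poch q (d * q * γ / (a * sP q a b c d)) *
            poch q (c * q * γ / (b * sP q a b c d)) * poch q (d * q * γ / (b * sP q a b c d)) *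
            poch q (sP q a b c d * γ) /
          (theta q (c * w) * theta q (d * w) * poch q (q * γ ^ 2) * poch q (γ ^ 2) *
            poch q (sP q a b c d / γ))) *
        (theta q (b * w) * theta q (a * (sP q a b c d / γ) * w) *
          theta q (b * (sP q a b c d / γ) * z) / (theta q (a / b) * theta q (b * z))) := by
  have hq : (q : ℂ) ≠ 0 := by exact_mod_cast h0.ne'
  have hw' : (w : ℂ) ≠ 0 := by exact_mod_cast hw
  simp only [dz, cz]
  generalize sP q a b c d = s at *
  have e1 : a * s * w / (q * γ) = a * (s / γ) * w / q := by field_simp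
  have e2 : ∀ x : ℂ, x * q / (a * s * γ⁻¹) = x * q * γ / (a * s) := fun x => by field_simp
  have e3 : b * s * z * γ⁻¹ = b * (s / γ) * z := by ring
  have e4 : (1 : ℂ) / γ⁻¹ ^ 2 = γ ^ 2 := by simp
  rw [e1, theta_div_base h0 h1 (by simp [*]), e2, e2, e3, e4, div_inv_eq_mul, mul_comm s b]
  refine Eq.trans ?_ (one_mul _)
  rw [← div_self (mul_ne_zero hca hda)]
  ring

end Parameters

/-- the Casorati determinant `v(γ) = D(Φ_γ^+, Φ_γ^-)`, expressed through
the expansion coefficients `c_z` and `d_z`. -/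
theorem statement13 (q zm zp : ℝ) (a b c d : ℂ)
    (hq0 : 0 < q) (hq1 : q < 1) (hzm : zm < 0) (hzp : 0 < zp)
    (hPg : memPgen q zm zp a b c d) (γ : ℂ) (hγ : Sreg q γ)
    (hpol : ∀ j : ℕ, γ ≠ sP q a b c d * (q : ℂ) ^ j) :
    (γ - 1 / γ) * Kz q a b c d zp *
        (dz q a b c d zm γ * cz q a b c d zp γ⁻¹ +
          dz q b a c d zm γ * cz q b a c d zp γ⁻¹) =
      vFun q zm zp a b c d γ := by
  obtain ⟨⟨ha, hb, hc, hd, hab, hlat, hpair, -⟩, -, hgen⟩ := hPg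
  have hn := norm_ofReal_lt_one hq0 hq1
  have hq : (q : ℂ) ≠ 0 := by exact_mod_cast hq0.ne'
  have hwC : (zm : ℂ) ≠ 0 := by exact_mod_cast hzm.ne
  have hzC : (zp : ℂ) ≠ 0 := by exact_mod_cast hzp.ne'
  have hs : sP q a b c d ≠ 0 := sP_ne_zero hq0 ha hb hc hd
  have hγ0 : γ ≠ 0 := hγ.1
  have hγsq := hγ.sq_ne_zpow hq0
  have hshift : ∀ {x y : ℂ}, (∀ k : ℤ, x / y ≠ (q : ℂ) ^ k) → poch q (x * q / y) ≠ 0 := by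
    intro x y h
    rw [mul_comm x, mul_div_assoc]
    exact poch_ne_zero_of_zpow hq0 hq1 (base_mul_ne_zpow hq0 h)
  have hθz : ∀ x ∈ ({a, b, c, d} : Set ℂ), theta q (x * zp) ≠ 0 := fun x hx =>
    theta_ne_zero hq0 hq1 fun k => mul_ne_zpow_of_ne_inv_mul hzp.ne' (hlat x hx k).1
  have hθw : ∀ x ∈ ({a, b, c, d} : Set ℂ), theta q (x * zm) ≠ 0 := fun x hx =>
    theta_ne_zero hq0 hq1 fun k => mul_ne_zpow_of_ne_inv_mul hzm.ne (hlat x hx k).2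
  have haz := hθz a (by simp)
  have hbz := hθz b (by simp)
  have hcz := hθz c (by simp)
  have hdz := hθz d (by simp)
  have hcw := hθw c (by simp)
  have hdw := hθw d (by simp)
  have hθab : theta q (a / b) ≠ 0 :=
    theta_ne_zero hq0 hq1 (hpair.div_ne_zpow hq0 hq1 hzm hzp hb hab)
  have hqγ : poch q (q * γ ^ 2) ≠ 0 := poch_ne_zero_of_zpow hq0 hq1 (base_mul_ne_zpow hq0 hγsq)
  have hγ1 : 1 - γ ^ 2 ≠ 0 := sub_ne_zero.2 (by simpa using (hγsq 0).symm)
  have hsγ : poch q (sP q a b c d / γ) ≠ 0 := by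
    refine poch_ne_zero hn fun j hj => hpol j ?_
    field_simp at hj
    exact hj.symm
  have h1 := dz_mul_cz_inv hq0 hq1 (w := zm) (z := zp) (b := b) (c := c) (d := d) ha hzm.ne hγ0 hs
    (hshift fun k => (hgen k).1) (hshift fun k => (hgen k).2.2.1)
  have h2 := dz_mul_cz_inv hq0 hq1 (w := zm) (z := zp) (a := b) (b := a) (c := c) (d := d) hb
    hzm.ne hγ0 (by rwa [sP_comm]) (hshift fun k => (hgen k).2.1)
    (hshift fun k => (hgen k).2.2.2.1)
  have hba : theta q (b / a) = -(b / a) * theta q (a / b) := by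
    have h := theta_inv hq0 hq1 (div_ne_zero ha hb)
    rwa [inv_div] at h
  rw [h1, h2, sP_comm q a b, hba, poch_eq_mul hn (γ ^ 2)]
  simp only [vFun, Kz]
  generalize sP q a b c d = s at *
  have h3 := theta_three_term hq0 hq1 ha hb (div_ne_zero hs hγ0) hwC hzC
  have e1 : a * b * s * zm * zp / (q * γ) = a * b * (s / γ) * zm * zp / q := by field_simp
  have e2 : theta q (s / γ) = poch q (s / γ) * poch q (q * γ / s) := by
    rw [theta, div_div_eq_mul_div]
  rw [e1, theta_div_base hq0 hq1 (by simp [*])]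
  rw [e2] at h3
  clear h1 h2 hba hγsq hpol hshift hθz hθw hlat hpair hgen hγ e1 e2
  generalize theta q (a * zp) = θ₀ at *
  generalize theta q (b * zp) = θ₁ at *
  generalize theta q (c * zp) = θ₂ at *
  generalize theta q (d * zp) = θ₃ at *
  generalize theta q (a * zm) = θ₄ at *
  generalize theta q (b * zm) = θ₅ at *
  generalize theta q (c * zm) = θ₆ at *
  generalize theta q (d * zm) = θ₇ at *
  generalize theta q (a / b) = θ₈ at *
  generalize theta q ((zm : ℂ) / zp) = θ₉ at *
  generalize theta q (a * (s / γ) * zm) = θ₁₀ at *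
  generalize theta q (b * (s / γ) * zm) = θ₁₁ at *
  generalize theta q (a * (s / γ) * zp) = θ₁₂ at *
  generalize theta q (b * (s / γ) * zp) = θ₁₃ at *
  generalize theta q (a * b * (s / γ) * zm * zp) = θ₁₄ at *
  generalize poch q (c * q * γ / (a * s)) = p₀ at *
  generalize poch q (d * q * γ / (a * s)) = p₁ at *
  generalize poch q (c * q * γ / (b * s)) = p₂ at *
  generalize poch q (d * q * γ / (b * s)) = p₃ at *
  generalize poch q (s * γ) = p₄ at *
  generalize poch q (s / γ) = p₅ at *
  generalize poch q (q * γ / s) = p₆ at *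
  generalize poch q (q * γ ^ 2) = p₇ at *
  field_simp at h3 ⊢
  linear_combination (γ ^ 2 - 1) * (1 - (q : ℂ)) * p₀ * p₁ * p₂ * p₃ * p₄ * h3
end VVBQJ
end
end
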